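/- arXiv:1705.04840 — 8 statements merged into one kernel-verified Lean document; each statement's English description precedes it below -/
import Mathlib

section
/- For every finite simple graph G on n ≥ 2 vertices and every integer λ ≥ 1, there exists a partition of the vertex set of G into λ blocks V_1, …, V_λ such that for every i ∈ {1,…,λ}, every connected component of the induced subgraph G[V_i] has diameter at most 4·n^{1/λ}·ln n. In other words, G admits a (λ, 4·n^{1/λ}·ln n) network decomposition. -/
lemma Real.log_natCast_mono : Monotone fun n : ℕ => Real.log n := by
  intro m n hmn
  rcases m.eq_zero_or_pos with rfl | hm
  · simpa using Real.log_natCast_nonneg n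
  · exact Real.log_le_log (by exact_mod_cast hm) (by exact_mod_cast hmn)

/-- Within the subgraph of `G` induced by `s`, any two vertices of the same connected component are
at distance at most `D`. -/
def SimpleGraph.ComponentDiamLE {V : Type*} (G : SimpleGraph V) (D : ℕ) (s : Set V) : Prop :=
  ∀ u w : s, (G.induce s).Reachable u w → (G.induce s).dist u w ≤ D

namespace SimpleGraph

variable {V : Type*} {G : SimpleGraph V} {D : ℕ} {s t : Set V}

lemma ComponentDiamLE.empty : G.ComponentDiamLE D ∅ := fun u => u.2.elim

lemma Reachable.induce_of_no_adj (hst : ∀ x ∈ s, ∀ y ∈ t \ s, ¬ G.Adj x y)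
    {u w : t} (h : (G.induce t).Reachable u w) (hu : u.1 ∈ s) :
    ∃ hw : w.1 ∈ s, (G.induce s).Reachable ⟨u, hu⟩ ⟨w, hw⟩ := by
  obtain ⟨p⟩ := h
  induction p with
  | nil => exact ⟨hu, Reachable.refl _⟩
  | @cons u v w huv p ih =>
    have hv : v.1 ∈ s := by
      by_contra hv
      exact hst _ hu _ ⟨v.2, hv⟩ huv
    obtain ⟨hw, hvw⟩ := ih hv
    have huv' : (G.induce s).Adj ⟨u, hu⟩ ⟨v, hv⟩ := huv
    exact ⟨hw, huv'.reachable.trans hvw⟩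

lemma ComponentDiamLE.dist_le_of_no_adj (h : G.ComponentDiamLE D s)
    (hst : ∀ x ∈ s, ∀ y ∈ t \ s, ¬ G.Adj x y) (hs : s ⊆ t)
    {u w : t} (huw : (G.induce t).Reachable u w) (hu : u.1 ∈ s) :
    (G.induce t).dist u w ≤ D := by
  obtain ⟨hw, hr⟩ := huw.induce_of_no_adj hst hu
  obtain ⟨p, hp⟩ := hr.exists_walk_length_eq_dist
  have hle := dist_le (p.map (induceHomOfLE G hs).toHom)
  rw [Walk.length_map, hp] at hle
  exact hle.trans (h _ _ hr)

lemma ComponentDiamLE.union (hs : G.ComponentDiamLE D s) (ht : G.ComponentDiamLE D t)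
    (hst : ∀ x ∈ s, ∀ y ∈ t, ¬ G.Adj x y) : G.ComponentDiamLE D (s ∪ t) := by
  rintro ⟨u, hu | hu⟩ w huw
  · refine hs.dist_le_of_no_adj (fun x hx y hy => hst x hx y ?_) Set.subset_union_left huw hu
    exact hy.1.resolve_left hy.2
  · refine ht.dist_le_of_no_adj (fun x hx y hy hxy => hst y ?_ x hx hxy.symm)
      Set.subset_union_right huw hu
    exact hy.1.resolve_right hy.2

lemma ComponentDiamLE.of_center {r : ℕ} {v : V} (hv : v ∈ s)
    (h : ∀ x (hx : x ∈ s), ∃ p : (G.induce s).Walk ⟨v, hv⟩ ⟨x, hx⟩, p.length ≤ r) :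
    G.ComponentDiamLE (2 * r) s := by
  rintro ⟨u, hu⟩ ⟨w, hw⟩ _
  obtain ⟨p, hp⟩ := h u hu
  obtain ⟨q, hq⟩ := h w hw
  have := dist_le (p.reverse.append q)
  rw [Walk.length_append, Walk.length_reverse] at this
  omega

open Classical in
/-- The ball of radius `r` around `v` in the subgraph of `G` induced by `T`. -/
noncomputable def ballWithin (G : SimpleGraph V) (T : Finset V) (v : V) : ℕ → Finset V
  | 0 => {v}
  | r + 1 => ballWithin G T v r ∪ T.filter fun x => ∃ y ∈ ballWithin G T v r, G.Adj y x

variable {T : Finset V} {v : V}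

lemma ballWithin_subset_succ (r : ℕ) : G.ballWithin T v r ⊆ G.ballWithin T v (r + 1) := by
  classical
  exact Finset.subset_union_left

lemma mem_ballWithin_self (r : ℕ) : v ∈ G.ballWithin T v r := by
  induction r with
  | zero => simp [ballWithin]
  | succ r ih => exact ballWithin_subset_succ r ih

lemma ballWithin_subset (hv : v ∈ T) (r : ℕ) : G.ballWithin T v r ⊆ T := by
  classical
  induction r with
  | zero => simpa [ballWithin] using hv
  | succ r ih => exact Finset.union_subset ih (Finset.filter_subset _ _)

lemma exists_walk_ballWithin (r : ℕ) (x : V) (hx : x ∈ (G.ballWithin T v r : Set V)) :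
    ∃ p : (G.induce (G.ballWithin T v r : Set V)).Walk ⟨v, mem_ballWithin_self r⟩ ⟨x, hx⟩,
      p.length ≤ r := by
  classical
  induction r generalizing x with
  | zero =>
    obtain rfl : x = v := by simpa [ballWithin] using hx
    exact ⟨Walk.nil, le_rfl⟩
  | succ r ih =>
    have hsub : (G.ballWithin T v r : Set V) ⊆ G.ballWithin T v (r + 1) :=
      Finset.coe_subset.2 (ballWithin_subset_succ r)
    have extend (y : V) (hy : y ∈ (G.ballWithin T v r : Set V)) :
        ∃ p : (G.induce (G.ballWithin T v (r + 1) : Set V)).Walk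
          ⟨v, mem_ballWithin_self _⟩ ⟨y, hsub hy⟩, p.length ≤ r := by
      obtain ⟨p, hp⟩ := ih y hy
      exact ⟨p.map (induceHomOfLE G hsub).toHom, (Walk.length_map _ _).trans_le hp⟩
    rcases Finset.mem_union.1 (Finset.mem_coe.1 hx) with hx' | hx'
    · obtain ⟨p, hp⟩ := extend x hx'
      exact ⟨p, hp.trans r.le_succ⟩
    · obtain ⟨-, y, hy, hyx⟩ := Finset.mem_filter.1 hx'
      obtain ⟨p, hp⟩ := extend y hy
      have hadj : (G.induce (G.ballWithin T v (r + 1) : Set V)).Adj ⟨y, hsub hy⟩ ⟨x, hx⟩ := hyx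
      refine ⟨p.concat hadj, ?_⟩
      rw [Walk.length_concat]
      omega

lemma componentDiamLE_ballWithin {r R : ℕ} (h : r ≤ R) :
    G.ComponentDiamLE (2 * R) (G.ballWithin T v r : Set V) :=
  .of_center (mem_ballWithin_self r) fun x hx =>
    (exists_walk_ballWithin r x hx).imp fun _ hp => hp.trans h

lemma exists_ballWithin_slow_growth (hv : v ∈ T) {p : ℝ} {R : ℕ}
    (hR : Real.log T.card < p * (R + 1)) :
    ∃ r ≤ R, ((G.ballWithin T v (r + 1)).card : ℝ) - (G.ballWithin T v r).card ≤
      p * (G.ballWithin T v (r + 1)).card := by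
  by_contra! h
  have growth (r : ℕ) (hr : r ≤ R + 1) :
      Real.exp (p * r) ≤ (G.ballWithin T v r).card := by
    induction r with
    | zero => simp [ballWithin]
    | succ r ih =>
      have h1 := ih (by omega)
      have h2 := h r (by omega)
      have h3 : (G.ballWithin T v r).card ≤
          Real.exp (-p) * (G.ballWithin T v (r + 1)).card := by
        have := mul_le_mul_of_nonneg_right (Real.add_one_le_exp (-p))
          (Nat.cast_nonneg (α := ℝ) (G.ballWithin T v (r + 1)).card)
        linarith
      calc Real.exp (p * (r + 1 : ℕ)) = Real.exp p * Real.exp (p * r) := by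
            rw [← Real.exp_add]; push_cast; ring_nf
        _ ≤ Real.exp p * (Real.exp (-p) * (G.ballWithin T v (r + 1)).card) :=
            mul_le_mul_of_nonneg_left (h1.trans h3) (Real.exp_pos p).le
        _ = (G.ballWithin T v (r + 1)).card := by
            rw [← mul_assoc, ← Real.exp_add]; simp
  have hcard : Real.exp (p * (R + 1)) ≤ T.card := by
    have := growth (R + 1) le_rfl
    push_cast at this
    exact this.trans (by exact_mod_cast Finset.card_le_card (ballWithin_subset hv _))
  have hT : (0 : ℝ) < T.card := by exact_mod_cast Finset.card_pos.2 ⟨v, hv⟩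
  exact hR.not_ge ((Real.le_log_iff_exp_le hT).2 hcard)

open Classical in
/-- Ball carving: all but a `p`-fraction of `T` can be covered by a set whose induced components
have small diameter. -/
lemma exists_componentDiamLE_subset (G : SimpleGraph V) {p : ℝ} {R : ℕ}
    (T : Finset V) (hR : Real.log T.card < p * (R + 1)) :
    ∃ A ⊆ T, G.ComponentDiamLE (2 * R) (A : Set V) ∧ ((T \ A).card : ℝ) ≤ p * T.card := by
  induction T using Finset.strongInduction with
  | H T ih =>
    rcases T.eq_empty_or_nonempty with rfl | ⟨v, hv⟩
    · exact ⟨∅, subset_rfl, by simpa using ComponentDiamLE.empty, by simp⟩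
    obtain ⟨r, hr, hgrow⟩ := exists_ballWithin_slow_growth (G := G) hv hR
    set B := G.ballWithin T v r
    set C := G.ballWithin T v (r + 1)
    have hBC : B ⊆ C := ballWithin_subset_succ r
    have hCT : C ⊆ T := ballWithin_subset hv _
    have hvC : v ∈ C := mem_ballWithin_self _
    have hlog : Real.log (T \ C).card ≤ Real.log T.card :=
      Real.log_natCast_mono (Finset.card_le_card Finset.sdiff_subset)
    obtain ⟨A, hAT, hA, hcard⟩ :=
      ih (T \ C) (Finset.sdiff_ssubset hCT ⟨v, hvC⟩) (hlog.trans_lt hR)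
    refine ⟨B ∪ A, Finset.union_subset (hBC.trans hCT) (hAT.trans Finset.sdiff_subset), ?_, ?_⟩
    · rw [Finset.coe_union]
      refine (componentDiamLE_ballWithin hr).union hA fun x hx y hy hxy => ?_
      obtain ⟨hyT, hyC⟩ := Finset.mem_sdiff.1 (hAT hy)
      refine hyC (Finset.mem_union_right _ ?_)
      exact Finset.mem_filter.2 ⟨hyT, x, hx, hxy⟩
    · have hsub : T \ (B ∪ A) ⊆ (C \ B) ∪ ((T \ C) \ A) := by
        intro x
        simp only [Finset.mem_sdiff, Finset.mem_union]
        tauto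
      have hle : ((T \ (B ∪ A)).card : ℝ) ≤ (C \ B).card + ((T \ C) \ A).card := by
        exact_mod_cast (Finset.card_le_card hsub).trans (Finset.card_union_le _ _)
      have h1 : ((C \ B).card : ℝ) = C.card - B.card := by
        rw [Finset.card_sdiff_of_subset hBC, Nat.cast_sub (Finset.card_le_card hBC)]
      have h2 : ((T \ C).card : ℝ) = T.card - C.card := by
        rw [Finset.card_sdiff_of_subset hCT, Nat.cast_sub (Finset.card_le_card hCT)]
      rw [h2] at hcard
      linarith

/-- Iterated ball carving decomposes `S` into `k` blocks as soon as `|S| p ^ k < 1`. -/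
lemma exists_coloring_componentDiamLE (G : SimpleGraph V) {p : ℝ} (hp : 0 ≤ p) {R : ℕ} (k : ℕ)
    (S : Finset V) (hR : Real.log S.card < p * (R + 1)) (hS : S.card * p ^ k < 1) :
    ∃ f : V → ℕ, (∀ v ∈ S, f v < k) ∧
      ∀ i < k, G.ComponentDiamLE (2 * R) {v | v ∈ S ∧ f v = i} := by
  classical
  induction k generalizing S with
  | zero =>
    have : S.card = 0 := by
      rw [pow_zero, mul_one] at hS
      exact Nat.lt_one_iff.1 (by exact_mod_cast hS)
    obtain rfl := Finset.card_eq_zero.1 this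
    exact ⟨fun _ => 0, by simp, by simp⟩
  | succ k ih =>
    obtain ⟨A, hAS, hA, hcard⟩ := exists_componentDiamLE_subset G S hR
    have hlog : Real.log (S \ A).card ≤ Real.log S.card :=
      Real.log_natCast_mono (Finset.card_le_card Finset.sdiff_subset)
    obtain ⟨f, hfk, hf⟩ := ih (S \ A) (hlog.trans_lt hR) <| by
      refine (mul_le_mul_of_nonneg_right hcard (pow_nonneg hp k)).trans_lt ?_
      rwa [mul_comm p, mul_assoc, ← pow_succ']
    refine ⟨fun v => if v ∈ A then k else f v, fun v hv => ?_, fun i hi => ?_⟩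
    · by_cases hvA : v ∈ A
      · simp [hvA]
      · have := hfk v (Finset.mem_sdiff.2 ⟨hv, hvA⟩)
        simp only [hvA, if_false]
        omega
    · rcases (Nat.lt_succ_iff.1 hi).eq_or_lt with rfl | hik
      · convert hA using 1
        ext v
        simp only [Set.mem_ofPred_eq, Finset.mem_coe]
        refine ⟨fun ⟨hv, hi⟩ => ?_, fun hv => ⟨hAS hv, if_pos hv⟩⟩
        by_contra hvA
        rw [if_neg hvA] at hi
        exact (hfk v (Finset.mem_sdiff.2 ⟨hv, hvA⟩)).ne hi
      · convert hf i hik using 1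
        ext v
        by_cases hvA : v ∈ A
        · simp [hvA, hik.ne']
        · simp [hvA]

end SimpleGraph

/-- Every finite simple graph `G` on `n ≥ 2` vertices admits, for every
integer `λ ≥ 1`, a `(λ, 4·n^{1/λ}·ln n)` network decomposition: a partition of the vertices
into `λ` blocks (given here by a coloring `f : V → Fin l`) such that in each block's induced
subgraph every connected component has diameter at most `4·n^{1/λ}·ln n`, i.e. any two
vertices of a block that are reachable within the block are at induced-graph distance
at most `4·n^{1/λ}·ln n`. -/
theorem stmt_0 {V : Type*} [Fintype V] (G : SimpleGraph V)
    (hn : 2 ≤ Fintype.card V) (l : ℕ) (hl : 1 ≤ l) :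
    ∃ f : V → Fin l, ∀ i : Fin l,
      ∀ u w : ({v : V | f v = i} : Set V),
        (G.induce {v : V | f v = i}).Reachable u w →
          ((G.induce {v : V | f v = i}).dist u w : ℝ) ≤
            4 * (Fintype.card V : ℝ) ^ ((1 : ℝ) / l) * Real.log (Fintype.card V) := by
  set n : ℝ := (Fintype.card V : ℝ) with hn_def
  have hn0 : 0 < n := by
    rw [hn_def]
    exact_mod_cast (by omega : 0 < Fintype.card V)
  set q : ℝ := n ^ ((1 : ℝ) / l) with hq_def
  have hq : 0 < q := Real.rpow_pos_of_pos hn0 _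
  have hql : q ^ l = n := by
    rw [hq_def, one_div]
    exact Real.rpow_inv_natCast_pow hn0.le (by omega)
  have hlog : 0 ≤ Real.log n := Real.log_natCast_nonneg _
  set R : ℕ := ⌊2 * q * Real.log n⌋₊ with hR_def
  have hRle : (R : ℝ) ≤ 2 * q * Real.log n := Nat.floor_le (by positivity)
  have hRlt : 2 * q * Real.log n < R + 1 := Nat.lt_floor_add_one _
  obtain ⟨f, hfl, hf⟩ := G.exists_coloring_componentDiamLE (p := (2 * q)⁻¹) (by positivity)
    (R := R) l Finset.univ
    (by
      rw [Finset.card_univ, inv_mul_eq_div, lt_div_iff₀ (by positivity)]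
      linarith)
    (by
      rw [Finset.card_univ, ← hn_def, inv_pow, mul_pow, hql, ← div_eq_mul_inv,
        div_lt_one (by positivity)]
      exact lt_mul_of_one_lt_left hn0 (one_lt_pow₀ one_lt_two (by omega)))
  refine ⟨fun v => ⟨f v, hfl v (Finset.mem_univ v)⟩, fun i => ?_⟩
  have hblock : {v | v ∈ Finset.univ ∧ f v = i} =
      {v | (⟨f v, hfl v (Finset.mem_univ v)⟩ : Fin l) = i} := by
    ext v
    simp [Fin.ext_iff]
  have hi := hf i i.2
  rw [hblock] at hi
  intro u w huw
  have hD : ((2 * R : ℕ) : ℝ) ≤ 4 * q * Real.log n := by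
    push_cast
    linarith
  exact (Nat.cast_le.2 (hi u w huw)).trans hD
end

section
/- Let H be a finite simple graph on n vertices whose maximum degree is at most D, where D ≥ 1, and let k ≥ 1 be an integer. Then the number of k-element vertex subsets U of H such that the induced subgraph H[U] is connected is at most n·(4D)^k. -/
/-- A connected vertex set meeting `U` and avoiding the outer neighbours of `U` lies in `U`. -/
theorem SimpleGraph.subset_of_induce_preconnected {V : Type*} (H : SimpleGraph V)
    {U W : Set V} (hW : (H.induce W).Preconnected) {v : V} (hvU : v ∈ U) (hvW : v ∈ W)
    (h : ∀ x ∈ U, ∀ y ∈ W, H.Adj x y → y ∈ U) : W ⊆ U := by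
  intro w hw
  have hr := (SimpleGraph.reachable_iff_reflTransGen _ _).1 (hW ⟨v, hvW⟩ ⟨w, hw⟩)
  have key : ∀ z : W, Relation.ReflTransGen (H.induce W).Adj ⟨v, hvW⟩ z → (z : V) ∈ U := by
    intro z hz
    induction hz with
    | refl => exact hvU
    | tail _ hbc ih => exact h _ ih _ (Subtype.property _) hbc
  exact key _ hr

/-- The total weight of the sets containing `U` and disjoint from `B`, where every absent vertex
contributes a factor `a`. -/
theorem Finset.sum_pow_card_compl_of_subset_of_disjoint {V : Type*} [Fintype V] [DecidableEq V]
    (a : ℕ) {U B : Finset V} (hUB : Disjoint U B) :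
    ∑ S : Finset V with U ⊆ S ∧ Disjoint S B, a ^ Sᶜ.card =
      a ^ B.card * (a + 1) ^ (U ∪ B)ᶜ.card := by
  rw [add_comm a 1, ← Finset.sum_pow_mul_eq_add_pow, Finset.mul_sum]
  symm
  refine Finset.sum_bij' (fun T _ => U ∪ T) (fun S _ => S \ U) ?_ ?_ ?_ ?_ ?_
  · intro T hT
    have hT' := Finset.mem_powerset.1 hT
    simp only [Finset.mem_filter, Finset.mem_univ, true_and]
    refine ⟨Finset.subset_union_left, Finset.disjoint_union_left.2 ⟨hUB, ?_⟩⟩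
    rw [Finset.disjoint_left]
    intro x hx hxB
    have := hT' hx
    simp [hxB] at this
  · intro S hS
    simp only [Finset.mem_filter, Finset.mem_univ, true_and] at hS
    rw [Finset.mem_powerset]
    intro x hx
    have := Finset.disjoint_left.1 hS.2 (Finset.mem_sdiff.1 hx).1
    simp_all
  · intro T hT
    have hT' := Finset.mem_powerset.1 hT
    ext x
    have := @hT' x
    simp at this ⊢
    tauto
  · intro S hS
    simp only [Finset.mem_filter, Finset.mem_univ, true_and] at hS
    exact Finset.union_sdiff_of_subset hS.1
  · intro T hT
    have hT' := Finset.mem_powerset.1 hT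
    rw [one_pow, one_mul, ← pow_add, ← Finset.card_sdiff_of_subset hT',
      ← Finset.card_union_of_disjoint]
    · congr 2
      ext x
      have h1 := @hT' x
      have h2 : x ∈ U → x ∉ B := fun hx => Finset.disjoint_left.1 hUB hx
      simp at h1 ⊢
      tauto
    · rw [Finset.disjoint_left]
      intro x hx
      simp [hx]

theorem Nat.add_one_pow_add_one_le_four_mul {D : ℕ} (hD : 1 ≤ D) :
    (D + 1) ^ (D + 1) ≤ 4 * D * D ^ D := by
  have hD' : (1 : ℝ) ≤ D := by exact_mod_cast hD
  have hpos : (0 : ℝ) < D + 1 := by positivity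
  have hx : (1 : ℝ) + -1 / (D + 1) = D / (D + 1) := by field_simp; ring
  have hB := one_add_mul_self_le_rpow_one_add (s := -1 / ((D : ℝ) + 1))
    (by rw [le_div_iff₀ hpos]; linarith) (p := ((D : ℝ) + 1) / 2) (by linarith)
  have hl : (1 : ℝ) + ((D : ℝ) + 1) / 2 * (-1 / (D + 1)) = 1 / 2 := by field_simp; norm_num
  rw [hl, hx] at hB
  have hsq : ((D / (D + 1) : ℝ) ^ (((D : ℝ) + 1) / 2)) ^ 2 = (D / (D + 1) : ℝ) ^ (D + 1) := by
    rw [← Real.rpow_natCast, ← Real.rpow_mul (by positivity), ← Real.rpow_natCast]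
    congr 1
    push_cast
    ring
  have h4 : (1 / 4 : ℝ) ≤ (D / (D + 1) : ℝ) ^ (D + 1) := by rw [← hsq]; nlinarith
  rw [div_pow, le_div_iff₀ (by positivity)] at h4
  have : ((D : ℝ) + 1) ^ (D + 1) ≤ 4 * D * D ^ D := by
    rw [pow_succ (D : ℝ) D] at h4
    linarith
  exact_mod_cast this

open Classical in
/-- The number of connected `k`-sets through a fixed vertex `v` is at most `(4D)^k`. The proof
weighs all vertex sets as in site percolation: the events that the cluster of `v` is `U` are
disjoint for distinct `U`. -/
theorem SimpleGraph.card_connected_through_vertex_le {V : Type*} [Fintype V] (H : SimpleGraph V)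
    [DecidableRel H.Adj] {D : ℕ} (hD : 1 ≤ D) (hdeg : H.maxDegree ≤ D) (k : ℕ) (v : V) :
    (Finset.univ.filter fun U : Finset V =>
      U.card = k ∧ (H.induce (↑U : Set V)).Connected ∧ v ∈ U).card ≤ (4 * D) ^ k := by
  set C := Finset.univ.filter fun U : Finset V =>
    U.card = k ∧ (H.induce (↑U : Set V)).Connected ∧ v ∈ U with hC
  let B : Finset V → Finset V := fun U => (U.biUnion fun u => H.neighborFinset u) \ U
  let F : Finset V → Finset (Finset V) := fun U =>
    Finset.univ.filter fun S => U ⊆ S ∧ Disjoint S (B U)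
  have hcard : ∀ U ∈ C, (B U).card ≤ D * k := by
    intro U hU
    rw [← (Finset.mem_filter.1 hU).2.1, mul_comm]
    exact (Finset.card_le_card Finset.sdiff_subset).trans
      (Finset.card_biUnion_le_card_mul _ _ _ fun u _ => (H.degree_le_maxDegree u).trans hdeg)
  have hsub : ∀ U ∈ C, ∀ W ∈ C, ∀ S, S ∈ F U → S ∈ F W → W ⊆ U := by
    intro U hU W hW S hSU hSW
    have hU' := (Finset.mem_filter.1 hU).2
    have hW' := (Finset.mem_filter.1 hW).2
    have hSU' := (Finset.mem_filter.1 hSU).2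
    have hSW' := (Finset.mem_filter.1 hSW).2
    refine Finset.coe_subset.1 (H.subset_of_induce_preconnected hW'.2.1.preconnected
      (Finset.mem_coe.2 hU'.2.2) (Finset.mem_coe.2 hW'.2.2) ?_)
    intro x hx y hy hxy
    by_contra hyU
    refine Finset.disjoint_left.1 hSU'.2 (hSW'.1 hy) (Finset.mem_sdiff.2 ⟨?_, hyU⟩)
    exact Finset.mem_biUnion.2 ⟨x, hx, (H.mem_neighborFinset x y).2 hxy⟩
  have hdisj : (C : Set (Finset V)).PairwiseDisjoint F := by
    intro U hU W hW hne
    refine Finset.disjoint_left.2 fun S hSU hSW => hne ?_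
    exact (hsub W hW U hU S hSW hSU).antisymm (hsub U hU W hW S hSU hSW)
  have htotal : ∑ S : Finset V, D ^ Sᶜ.card = (D + 1) ^ Fintype.card V := by
    simpa using Finset.sum_pow_card_compl_of_subset_of_disjoint D
      (Finset.disjoint_empty_left (∅ : Finset V))
  have hsum : ∑ U ∈ C, D ^ (B U).card * (D + 1) ^ (U ∪ B U)ᶜ.card ≤
      (D + 1) ^ Fintype.card V := by
    rw [← htotal]
    calc _ = ∑ U ∈ C, ∑ S ∈ F U, D ^ Sᶜ.card := Finset.sum_congr rfl fun U _ =>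
          (Finset.sum_pow_card_compl_of_subset_of_disjoint D Finset.disjoint_sdiff).symm
      _ = ∑ S ∈ C.biUnion F, D ^ Sᶜ.card := (Finset.sum_biUnion hdisj).symm
      _ ≤ _ := Finset.sum_le_sum_of_subset (Finset.subset_univ _)
  have hterm : ∀ U ∈ C, (D + 1) ^ Fintype.card V * D ^ (D * k) ≤
      D ^ (B U).card * (D + 1) ^ (U ∪ B U)ᶜ.card * (D + 1) ^ ((D + 1) * k) := by
    intro U hU
    have hn : (U ∪ B U)ᶜ.card + (k + (B U).card) = Fintype.card V := by
      rw [← (Finset.mem_filter.1 hU).2.1,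
        ← Finset.card_union_of_disjoint Finset.disjoint_sdiff, Finset.card_compl_add_card]
    obtain ⟨c, hc⟩ := Nat.exists_eq_add_of_le (hcard U hU)
    rw [← hn, add_mul, hc, one_mul]
    calc _ = (D + 1) ^ ((U ∪ B U)ᶜ.card + (k + (B U).card)) * D ^ (B U).card * D ^ c := by ring
      _ ≤ (D + 1) ^ ((U ∪ B U)ᶜ.card + (k + (B U).card)) * D ^ (B U).card * (D + 1) ^ c := by
          gcongr; omega
      _ = _ := by ring
  have hmul : C.card * D ^ (D * k) ≤ (D + 1) ^ ((D + 1) * k) := by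
    refine Nat.le_of_mul_le_mul_left ?_ (show 0 < (D + 1) ^ Fintype.card V by positivity)
    calc _ = ∑ U ∈ C, (D + 1) ^ Fintype.card V * D ^ (D * k) := by
          rw [Finset.sum_const, smul_eq_mul]; ring
      _ ≤ ∑ U ∈ C, D ^ (B U).card * (D + 1) ^ (U ∪ B U)ᶜ.card * (D + 1) ^ ((D + 1) * k) :=
          Finset.sum_le_sum hterm
      _ ≤ _ := by rw [← Finset.sum_mul]; gcongr
  refine Nat.le_of_mul_le_mul_right (hmul.trans ?_) (show 0 < D ^ (D * k) by positivity)
  rw [pow_mul, pow_mul, ← mul_pow]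
  exact Nat.pow_le_pow_left (Nat.add_one_pow_add_one_le_four_mul hD) k

/-- In a finite simple graph `H` on `n` vertices of maximum degree at most
`D ≥ 1`, for every `k ≥ 1` the number of `k`-element vertex subsets `U` such that the induced
subgraph `H[U]` is connected is at most `n · (4D)^k`. -/
theorem stmt_4 {V : Type*} [Fintype V] (H : SimpleGraph V) [DecidableRel H.Adj]
    (D : ℕ) (hD : 1 ≤ D) (hdeg : H.maxDegree ≤ D) (k : ℕ) (hk : 1 ≤ k) :
    Nat.card {U : Finset V // U.card = k ∧ (H.induce (↑U : Set V)).Connected} ≤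
      Fintype.card V * (4 * D) ^ k := by
  classical
  rw [Nat.card_eq_fintype_card, Fintype.card_subtype]
  refine (Finset.card_le_card ?_).trans (Finset.card_biUnion_le_card_mul Finset.univ
    (fun v => Finset.univ.filter fun U : Finset V =>
      U.card = k ∧ (H.induce (↑U : Set V)).Connected ∧ v ∈ U) _
    fun v _ => by convert H.card_connected_through_vertex_le hD hdeg k v)
  intro U hU
  have hU' := (Finset.mem_filter.1 hU).2
  obtain ⟨v, hv⟩ := Finset.card_pos.1 (show 0 < U.card by omega)
  exact Finset.mem_biUnion.2 ⟨v, Finset.mem_univ v,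
    Finset.mem_filter.2 ⟨Finset.mem_univ U, hU'.1, hU'.2, hv⟩⟩
end

section
/- Let G be a finite simple graph with maximum degree at most Δ, where Δ ≥ 1, let f ≥ 1 be an integer, and let k = ⌈2Δ/f⌉. Consider the random coloring in which each vertex independently and uniformly at random picks a color from {1,…,k} (i.e., the product over the vertices of the uniform measure on {1,…,k}). Then for every vertex v, the probability that strictly more than f neighbors u of v satisfy c(u) = c(v) is at most e^{−f/6}. -/
open MeasureTheory

/-- The generating function, at `2`, of the number of `u ∈ N` colored like `v`. -/
lemma sum_two_pow_card_filter_eq {V : Type*} [Fintype V] [DecidableEq V] (k : ℕ) (hk : 0 < k)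
    (N : Finset V) (v : V) (hv : v ∉ N) :
    ∑ c : V → Fin k, (2 : ℝ) ^ (N.filter fun u => c u = c v).card =
      (k : ℝ) ^ Fintype.card V * (1 + (k : ℝ)⁻¹) ^ N.card := by
  have hk0 : (k : ℝ) ≠ 0 := by positivity
  let w : Fin k → V → Fin k → ℝ := fun a u x =>
    (if u = v then (if x = a then 1 else 0) else 1) *
      (if u ∈ N then (if x = a then 2 else 1) else 1)
  have pow_eq (c : V → Fin k) :
      (2 : ℝ) ^ (N.filter fun u => c u = c v).card = ∑ a, ∏ u, w a u (c u) := by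
    simp only [w, Finset.prod_mul_distrib, Finset.prod_ite_eq', Finset.prod_ite_mem,
      Finset.mem_univ, if_true, Finset.univ_inter]
    simp only [ite_mul, one_mul, zero_mul, Finset.sum_ite_eq, Finset.mem_univ, if_true]
    rw [← Finset.prod_filter, Finset.prod_const]
  have sum_eq (a : Fin k) (u : V) : ∑ x, w a u x =
      k * ((if u = v then (k : ℝ)⁻¹ else 1) * (if u ∈ N then 1 + (k : ℝ)⁻¹ else 1)) := by
    by_cases h : u = v
    · subst h
      simp [w, hv, hk0]
    · by_cases hN : u ∈ N
      · have split (x : Fin k) : (if x = a then (2 : ℝ) else 1) = 1 + if x = a then 1 else 0 := by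
          split_ifs <;> norm_num
        simp [w, h, hN, split, Finset.sum_add_distrib]
        field_simp
      · simp [w, h, hN]
  calc ∑ c : V → Fin k, (2 : ℝ) ^ (N.filter fun u => c u = c v).card
      = ∑ a, ∑ c : V → Fin k, ∏ u, w a u (c u) := by
        simp_rw [pow_eq]
        exact Finset.sum_comm
    _ = ∑ a, ∏ u, ∑ x, w a u x := by simp_rw [Fintype.prod_sum]
    _ = _ := by
        simp only [sum_eq, Finset.prod_mul_distrib, Finset.prod_ite_eq', Finset.prod_ite_mem,
          Finset.mem_univ, if_true, Finset.univ_inter, Finset.prod_const, Finset.sum_const,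
          Finset.card_univ, Fintype.card_fin, nsmul_eq_mul]
        field_simp

/-- The measure of a set under the uniform product measure, by counting. -/
lemma pi_uniform_apply {V : Type*} [Fintype V] (k : ℕ) (hk : 0 < k)
    (s : Finset (V → Fin k)) :
    Measure.pi (fun _ : V => ((k : ENNReal))⁻¹ • (Measure.count : Measure (Fin k))) s =
      ENNReal.ofReal (s.card / (k : ℝ) ^ Fintype.card V) := by
  have hk' : (0 : ℝ) < k := by exact_mod_cast hk
  have : SigmaFinite (((k : ENNReal))⁻¹ • (Measure.count : Measure (Fin k))) :=
    (Measure.smul_finite _ (by simp [hk.ne'])).toSigmaFinite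
  rw [← sum_measure_singleton]
  simp only [Measure.pi_singleton, Measure.smul_apply, Measure.count_singleton, smul_eq_mul,
    mul_one, Finset.prod_const, Finset.sum_const, Finset.card_univ, nsmul_eq_mul]
  rw [div_eq_mul_inv, ENNReal.ofReal_mul (by positivity), ENNReal.ofReal_natCast,
    ← inv_pow, ENNReal.ofReal_pow (by positivity), ENNReal.ofReal_inv_of_pos hk',
    ENNReal.ofReal_natCast]

/-- A numerical form of the Chernoff bound for mean `d / k ≤ f / 2` at exponent `log 2`. -/
lemma one_add_inv_pow_le {k d f : ℕ} (hk : 0 < k) (h : 2 * (d : ℝ) ≤ f * k) :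
    (1 + (k : ℝ)⁻¹) ^ d ≤ 2 ^ f * Real.exp (-(f : ℝ) / 6) := by
  have hk' : (0 : ℝ) < k := by exact_mod_cast hk
  have hdk : (d : ℝ) * (k : ℝ)⁻¹ ≤ f / 2 := by
    rw [← div_eq_mul_inv, div_le_iff₀ hk']
    linarith
  have hlog := Real.log_two_gt_d9
  calc (1 + (k : ℝ)⁻¹) ^ d ≤ Real.exp ((k : ℝ)⁻¹) ^ d := by
        gcongr
        linarith [Real.add_one_le_exp ((k : ℝ)⁻¹)]
    _ = Real.exp (d * (k : ℝ)⁻¹) := (Real.exp_nat_mul _ _).symm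
    _ ≤ Real.exp (f * Real.log 2 + -(f : ℝ) / 6) := by
        gcongr
        nlinarith [Nat.cast_nonneg (α := ℝ) f]
    _ = 2 ^ f * Real.exp (-(f : ℝ) / 6) := by
        rw [Real.exp_add, Real.exp_nat_mul, Real.exp_log two_pos]

/-- Let `G` have maximum degree at most `Δ ≥ 1`, let `f ≥ 1`, and let
`k = ⌈2Δ/f⌉`. Under the product over all vertices of the uniform measure on the `k` colors,
for each vertex `v` the probability that strictly more than `f` neighbors `u` of `v` get
`c(u) = c(v)` is at most `e^{-f/6}`. (The uniform measure on `Fin k` is written as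
`k⁻¹ • count`.) -/
theorem stmt_7 {V : Type*} [Fintype V] (G : SimpleGraph V) [DecidableRel G.Adj]
    (Δ f : ℕ) (hΔ : 1 ≤ Δ) (hf : 1 ≤ f) (hdeg : G.maxDegree ≤ Δ)
    (k : ℕ) (hk : k = ⌈(2 * (Δ : ℝ)) / (f : ℝ)⌉₊) (v : V) :
    Measure.pi (fun _ : V => ((k : ENNReal))⁻¹ • (Measure.count : Measure (Fin k)))
        {c : V → Fin k | f < ((G.neighborFinset v).filter fun u => c u = c v).card} ≤
      ENNReal.ofReal (Real.exp (-(f : ℝ) / 6)) := by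
  classical
  have hf' : (0 : ℝ) < f := by exact_mod_cast hf
  have hΔ' : (0 : ℝ) < Δ := by exact_mod_cast hΔ
  have hk0 : 0 < k := by
    rw [hk, Nat.ceil_pos]
    positivity
  have hd : ((G.neighborFinset v).card : ℝ) ≤ Δ := by
    exact_mod_cast (G.degree_le_maxDegree v).trans hdeg
  have hΔk : 2 * (Δ : ℝ) ≤ f * k := by
    have := Nat.le_ceil ((2 * (Δ : ℝ)) / (f : ℝ))
    rw [← hk, div_le_iff₀ hf'] at this
    linarith
  set X : (V → Fin k) → ℕ := fun c => ((G.neighborFinset v).filter fun u => c u = c v).card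
  let S : Finset (V → Fin k) := Finset.univ.filter fun c => f < X c
  have hS : {c : V → Fin k | f < X c} = (S : Set (V → Fin k)) := by
    ext c
    simp [S]
  have markov : (S.card : ℝ) * 2 ^ f ≤ ∑ c, (2 : ℝ) ^ X c := by
    calc (S.card : ℝ) * 2 ^ f = ∑ c ∈ S, (2 : ℝ) ^ f := by simp
      _ ≤ ∑ c ∈ S, (2 : ℝ) ^ X c := by
          refine Finset.sum_le_sum fun c hc => ?_
          exact pow_le_pow_right₀ one_le_two (Finset.mem_filter.mp hc).2.le
      _ ≤ ∑ c, (2 : ℝ) ^ X c :=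
          Finset.sum_le_sum_of_subset_of_nonneg (Finset.subset_univ S)
            fun c _ _ => by positivity
  rw [sum_two_pow_card_filter_eq k hk0 _ v (by simp)] at markov
  rw [hS, pi_uniform_apply k hk0]
  refine ENNReal.ofReal_le_ofReal ?_
  rw [div_le_iff₀ (by positivity)]
  have bound := one_add_inv_pow_le (f := f) (d := (G.neighborFinset v).card) hk0 (by linarith)
  refine le_of_mul_le_mul_right ?_ (by positivity : (0 : ℝ) < 2 ^ f)
  calc (S.card : ℝ) * 2 ^ f ≤ _ := markov
    _ ≤ (k : ℝ) ^ Fintype.card V * (2 ^ f * Real.exp (-(f : ℝ) / 6)) := by gcongr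
    _ = _ := by ring
end

section
/- Let G be a finite simple graph with maximum degree at most Δ, where Δ ≥ 1, and let f ≥ 1 be an integer such that e·e^{−f/6}·(Δ²+1) ≤ 1. Then G admits an f-defective coloring with ⌈2Δ/f⌉ colors, i.e., there exists a coloring c : V → {1,…,⌈2Δ/f⌉} such that every vertex has at most f neighbors u with c(u) = c(v). -/
/-- Isolating one index in the double sum of a symmetric function with zero diagonal. -/
theorem Finset.sum_sum_eq_two_mul_sum_add_sum_erase {V : Type*} [Fintype V] [DecidableEq V]
    (F : V → V → ℕ) (hsymm : ∀ x y, F x y = F y x) (hdiag : ∀ x, F x x = 0) (v : V) :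
    ∑ x, ∑ y, F x y =
      2 * ∑ y, F v y + ∑ x ∈ Finset.univ.erase v, ∑ y ∈ Finset.univ.erase v, F x y := by
  have hrow (x : V) : ∑ y, F x y = F x v + ∑ y ∈ Finset.univ.erase v, F x y :=
    (Finset.add_sum_erase _ _ (Finset.mem_univ v)).symm
  have hcol : ∑ x ∈ Finset.univ.erase v, F x v = ∑ y, F v y := by
    rw [hrow v, hdiag, zero_add]
    exact Finset.sum_congr rfl fun x _ => hsymm x v
  rw [← Finset.add_sum_erase _ _ (Finset.mem_univ v),
    Finset.sum_congr rfl fun x _ => hrow x, Finset.sum_add_distrib, hcol]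
  ring

/-- Some coloring is locally optimal: no vertex can lower the number of its neighbors of its own
color by switching to another color. -/
theorem SimpleGraph.exists_coloring_card_neighbors_same_color_le {V α : Type*} [Fintype V]
    (G : SimpleGraph V) [DecidableRel G.Adj] [Fintype α] [DecidableEq α] [Nonempty α] :
    ∃ c : V → α, ∀ (v : V) (a : α),
      ((G.neighborFinset v).filter fun u => c u = c v).card ≤
        ((G.neighborFinset v).filter fun u => c u = a).card := by
  classical
  let F (c : V → α) (x y : V) : ℕ := if G.Adj x y ∧ c y = c x then 1 else 0
  have hsplit (c : V → α) := Finset.sum_sum_eq_two_mul_sum_add_sum_erase (F c)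
    (fun x y => by simp only [F, G.adj_comm x y, eq_comm (a := c x)]) (fun x => by simp [F])
  have hcard (v : V) (p : V → Prop) [DecidablePred p] :
      ((G.neighborFinset v).filter p).card = ∑ y, if G.Adj v y ∧ p y then 1 else 0 := by
    rw [Finset.sum_boole, Nat.cast_id]
    congr 1
    ext y
    simp
  obtain ⟨c, hc⟩ := Finite.exists_min fun c : V → α => ∑ x, ∑ y, F c x y
  refine ⟨c, fun v a => ?_⟩
  have hmin := hc (Function.update c v a)
  rw [hsplit _ v, hsplit _ v] at hmin
  have hrest : ∑ x ∈ Finset.univ.erase v, ∑ y ∈ Finset.univ.erase v,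
      F (Function.update c v a) x y =
      ∑ x ∈ Finset.univ.erase v, ∑ y ∈ Finset.univ.erase v, F c x y := by
    refine Finset.sum_congr rfl fun x hx => Finset.sum_congr rfl fun y hy => ?_
    simp only [F, Function.update_of_ne (Finset.ne_of_mem_erase hx),
      Function.update_of_ne (Finset.ne_of_mem_erase hy)]
  have hrow : ∑ y, F (Function.update c v a) v y =
      ∑ y, if G.Adj v y ∧ c y = a then 1 else 0 := by
    refine Finset.sum_congr rfl fun y _ => ?_
    by_cases h : G.Adj v y
    · simp [F, Function.update_of_ne h.ne']
    · simp [F, h]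
  rw [hrest, hrow] at hmin
  rw [hcard, hcard]
  change ∑ y, F c v y ≤ _
  omega

/-- With `k` colors, some coloring gives each vertex `v` at most `deg v / k` neighbors of its own
color. -/
theorem SimpleGraph.exists_coloring_card_mul_card_neighbors_le_degree {V α : Type*} [Fintype V]
    (G : SimpleGraph V) [DecidableRel G.Adj] [Fintype α] [DecidableEq α] [Nonempty α] :
    ∃ c : V → α, ∀ v : V,
      Fintype.card α * ((G.neighborFinset v).filter fun u => c u = c v).card ≤ G.degree v := by
  obtain ⟨c, hc⟩ := G.exists_coloring_card_neighbors_same_color_le (α := α)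
  refine ⟨c, fun v => ?_⟩
  rw [← G.card_neighborFinset_eq_degree v,
    Finset.card_eq_sum_card_fiberwise (s := G.neighborFinset v) (f := c) (t := Finset.univ)
      (fun _ _ => Finset.mem_coe.2 (Finset.mem_univ _)), ← smul_eq_mul]
  exact Finset.card_nsmul_le_sum _ _ _ fun a _ => hc v a

/-- If `G` has maximum degree at most `Δ ≥ 1`, `f ≥ 1`, and
`e·e^{-f/6}·(Δ²+1) ≤ 1`, then `G` admits an `f`-defective coloring with `⌈2Δ/f⌉` colors:
a coloring in which every vertex has at most `f` neighbors of its own color. -/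
theorem stmt_8 {V : Type*} [Fintype V] (G : SimpleGraph V) [DecidableRel G.Adj]
    (Δ f : ℕ) (hΔ : 1 ≤ Δ) (hf : 1 ≤ f) (hdeg : G.maxDegree ≤ Δ)
    (hlll : Real.exp 1 * Real.exp (-(f : ℝ) / 6) * ((Δ : ℝ) ^ 2 + 1) ≤ 1) :
    ∃ c : V → Fin ⌈(2 * (Δ : ℝ)) / (f : ℝ)⌉₊,
      ∀ v : V, ((G.neighborFinset v).filter fun u => c u = c v).card ≤ f := by
  have hf0 : (0 : ℝ) < f := by exact_mod_cast hf
  have hΔ0 : (0 : ℝ) < Δ := by exact_mod_cast hΔ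
  have hk := (div_le_iff₀ hf0).1 (Nat.le_ceil (2 * (Δ : ℝ) / f))
  have hpos : 0 < ⌈2 * (Δ : ℝ) / f⌉₊ := Nat.ceil_pos.2 (by positivity)
  generalize ⌈2 * (Δ : ℝ) / f⌉₊ = k at hk hpos ⊢
  have hk' : 2 * Δ ≤ k * f := by exact_mod_cast hk
  have : NeZero k := ⟨hpos.ne'⟩
  obtain ⟨c, hc⟩ := G.exists_coloring_card_mul_card_neighbors_le_degree (α := Fin k)
  refine ⟨c, fun v => Nat.le_of_mul_le_mul_left ?_ hpos⟩
  have hv := hc v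
  rw [Fintype.card_fin] at hv
  have := G.degree_le_maxDegree v
  omega
end

section
/- For every finite simple graph G with maximum degree at most Δ, where Δ ≥ 1, and every integer β ≥ 1, there exists a proper coloring of G with at most ⌈120·Δ^{1+1/β}⌉ colors that is β-frugal, i.e., for every vertex v and every color q, at most β neighbors of v receive color q. -/
section FrugalCounting

open Finset

variable {V : Type*} [Fintype V] [DecidableEq V]

/-- The colorings of `V` whose restriction to `S` is proper and uses every color at most `β` times
in every neighborhood. -/
def frugalOn (G : SimpleGraph V) [DecidableRel G.Adj] (β k : ℕ) (S : Finset V) :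
    Finset (V → Fin k) :=
  {c | (∀ u ∈ S, ∀ v ∈ S, G.Adj u v → c u ≠ c v) ∧
    ∀ w q, #{u ∈ G.neighborFinset w ∩ S | c u = q} ≤ β}

theorem mem_frugalOn {G : SimpleGraph V} [DecidableRel G.Adj] {β k : ℕ} {S : Finset V}
    {c : V → Fin k} :
    c ∈ frugalOn G β k S ↔ (∀ u ∈ S, ∀ v ∈ S, G.Adj u v → c u ≠ c v) ∧
      ∀ w q, #{u ∈ G.neighborFinset w ∩ S | c u = q} ≤ β := by
  simp [frugalOn]

theorem frugalOn_anti (G : SimpleGraph V) [DecidableRel G.Adj] (β k : ℕ) {S T : Finset V}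
    (h : S ⊆ T) : frugalOn G β k T ⊆ frugalOn G β k S := by
  intro c hc
  rw [mem_frugalOn] at hc ⊢
  refine ⟨fun u hu v hv => hc.1 u (h hu) v (h hv), fun w q => le_trans ?_ (hc.2 w q)⟩
  exact card_le_card (filter_subset_filter _ (inter_subset_inter_left h))

theorem mem_frugalOn_congr {G : SimpleGraph V} [DecidableRel G.Adj] {β k : ℕ} {S : Finset V}
    {c d : V → Fin k} (h : ∀ u ∈ S, c u = d u) (hc : c ∈ frugalOn G β k S) :
    d ∈ frugalOn G β k S := by
  rw [mem_frugalOn] at hc ⊢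
  refine ⟨fun u hu v hv => by rw [← h u hu, ← h v hv]; exact hc.1 u hu v hv, fun w q => ?_⟩
  convert hc.2 w q using 2
  refine filter_congr fun u hu => ?_
  rw [h u (mem_inter.1 hu).2]

/-- Fixing the colors on a set `F` of unconstrained vertices to that of a vertex `t` outside `F`
divides the number of colorings by at least `k ^ #F`. -/
theorem card_frugalOn_monochromatic_mul_le (G : SimpleGraph V) [DecidableRel G.Adj] (β k : ℕ)
    {S F : Finset V} (hSF : Disjoint S F) {t : V} (ht : t ∉ F) :
    #{c ∈ frugalOn G β k S | ∀ u ∈ F, c u = c t} * k ^ #F ≤ #(frugalOn G β k S) := by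
  have hcard : k ^ #F = #(univ : Finset (F → Fin k)) := by simp
  rw [hcard, ← card_product]
  refine card_le_card_of_injOn
    (fun p u => if h : u ∈ F then p.2 ⟨u, h⟩ else p.1 u) ?_ ?_
  · rintro ⟨c, g⟩ hp
    simp only [coe_product, Set.mem_prod, mem_coe, mem_filter] at hp
    refine mem_frugalOn_congr (fun u hu => ?_) hp.1.1
    simp [disjoint_left.1 hSF hu]
  · rintro ⟨c, g⟩ hp ⟨d, g'⟩ hq heq
    simp only [coe_product, Set.mem_prod, mem_coe, mem_filter] at hp hq
    have hoff : ∀ u, u ∉ F → c u = d u := fun u hu => by simpa [hu] using congrFun heq u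
    refine Prod.ext (funext fun u => ?_) (funext fun u => ?_)
    · by_cases hu : u ∈ F
      · exact (hp.1.2 u hu).trans ((hoff t ht).trans (hq.1.2 u hu).symm)
      · exact hoff u hu
    · simpa using congrFun heq u

/-- A coloring that stops being frugal when `v` is added to `S` either repeats the color of `v` on
a neighbor of `v`, or repeats it on `β` vertices of `S` sharing a neighbor with `v`. -/
theorem frugalOn_subset_insert_union (G : SimpleGraph V) [DecidableRel G.Adj] (β k : ℕ)
    (S : Finset V) (v : V) :
    frugalOn G β k S ⊆ frugalOn G β k (insert v S) ∪
      ((G.neighborFinset v).biUnion (fun u => {c ∈ frugalOn G β k S | c v = c u}) ∪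
        (G.neighborFinset v).biUnion fun w =>
          ((G.neighborFinset w ∩ S).powersetCard β).biUnion fun T =>
            {c ∈ frugalOn G β k S | ∀ u ∈ T, c u = c v}) := by
  intro c hc
  by_contra hcon
  simp only [mem_union, mem_biUnion, mem_filter, not_or, not_exists, not_and, mem_powersetCard,
    SimpleGraph.mem_neighborFinset, hc, true_and] at hcon
  obtain ⟨hbad, hprop, hfrug⟩ := hcon
  have hc' := mem_frugalOn.1 hc
  refine hbad (mem_frugalOn.2 ⟨?_, fun w q => ?_⟩)
  · intro a ha b hb hab
    rcases mem_insert.1 ha with rfl | ha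
    · exact hprop b hab
    · rcases mem_insert.1 hb with rfl | hb
      · exact fun h => hprop a hab.symm h.symm
      · exact hc'.1 a ha b hb hab
  · by_contra! hlt
    by_cases hv : G.Adj w v ∧ c v = q
    · obtain ⟨hwv, rfl⟩ := hv
      have hsub : ({u ∈ G.neighborFinset w ∩ insert v S | c u = c v} : Finset V) ⊆
          insert v {u ∈ G.neighborFinset w ∩ S | c u = c v} := by
        intro u hu
        simp only [mem_filter, mem_inter, mem_insert] at hu ⊢
        tauto
      have hle := (card_le_card hsub).trans (card_insert_le _ _)
      obtain ⟨T, hT, hTcard⟩ := exists_subset_card_eq (show β ≤ _ by omega :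
        β ≤ #{u ∈ G.neighborFinset w ∩ S | c u = c v})
      exact hfrug w hwv.symm T ⟨hT.trans (filter_subset _ _), hTcard⟩
        fun u hu => (mem_filter.1 (hT hu)).2
    · refine absurd (hc'.2 w q) (not_le.2 (hlt.trans_le (card_le_card fun u hu => ?_)))
      simp only [mem_filter, mem_inter, mem_insert, SimpleGraph.mem_neighborFinset] at hu ⊢
      obtain ⟨⟨hwu, rfl | hu⟩, hq⟩ := hu
      · exact absurd ⟨hwu, hq⟩ hv
      · exact ⟨⟨hwu, hu⟩, hq⟩

theorem card_frugalOn_le_add (G : SimpleGraph V) [DecidableRel G.Adj] (β k : ℕ)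
    (S : Finset V) (v : V) :
    #(frugalOn G β k S) ≤ #(frugalOn G β k (insert v S)) +
      (∑ u ∈ G.neighborFinset v, #{c ∈ frugalOn G β k S | c v = c u} +
        ∑ w ∈ G.neighborFinset v, ∑ T ∈ (G.neighborFinset w ∩ S).powersetCard β,
          #{c ∈ frugalOn G β k S | ∀ u ∈ T, c u = c v}) := by
  refine (card_le_card (frugalOn_subset_insert_union G β k S v)).trans
    ((card_union_le _ _).trans (Nat.add_le_add_left ((card_union_le _ _).trans ?_) _))
  exact Nat.add_le_add card_biUnion_le
    (card_biUnion_le.trans (sum_le_sum fun w _ => card_biUnion_le))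

theorem pow_mul_card_frugalOn_sdiff_le (G : SimpleGraph V) [DecidableRel G.Adj] (β k : ℕ)
    {m : ℝ} (hm : 0 ≤ m) {S : Finset V}
    (ih : ∀ S' : Finset V, #S' < #S → ∀ v ∉ S',
      m * #(frugalOn G β k S') ≤ k * #(frugalOn G β k (insert v S')))
    {T : Finset V} (hT : T ⊆ S) :
    m ^ #T * #(frugalOn G β k (S \ T)) ≤ (k : ℝ) ^ #T * #(frugalOn G β k S) := by
  induction T using Finset.induction_on with
  | empty => simp
  | insert a T ha hind =>
    have haS : a ∈ S := hT (mem_insert_self _ _)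
    have hstep := ih (S \ insert a T)
      (card_lt_card (sdiff_ssubset hT (insert_nonempty _ _))) a (by simp)
    have hins : insert a (S \ insert a T) = S \ T := by
      ext u
      simp only [mem_insert, mem_sdiff, not_or]
      by_cases hu : u = a
      · subst hu; simp [haS, ha]
      · simp [hu]
    rw [hins] at hstep
    have hind := hind ((subset_insert _ _).trans hT)
    rw [card_insert_of_notMem ha, pow_succ, pow_succ]
    calc m ^ #T * m * #(frugalOn G β k (S \ insert a T))
        = m ^ #T * (m * #(frugalOn G β k (S \ insert a T))) := by ring
      _ ≤ m ^ #T * (k * #(frugalOn G β k (S \ T))) := by gcongr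
      _ = k * (m ^ #T * #(frugalOn G β k (S \ T))) := by ring
      _ ≤ k * ((k : ℝ) ^ #T * #(frugalOn G β k S)) := by gcongr
      _ = (k : ℝ) ^ #T * k * #(frugalOn G β k S) := by ring

theorem pow_mul_card_frugalOn_monochromatic_le (G : SimpleGraph V) [DecidableRel G.Adj]
    {β k : ℕ} (hβ : 1 ≤ β) (hk : 0 < k) {m : ℝ} (hm : 0 ≤ m) {S : Finset V}
    (ih : ∀ S' : Finset V, #S' < #S → ∀ v ∉ S',
      m * #(frugalOn G β k S') ≤ k * #(frugalOn G β k (insert v S')))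
    {v : V} (hv : v ∉ S) {T : Finset V} (hT : T ⊆ S) (hTcard : #T = β) :
    m ^ (β - 1) * (k * #{c ∈ frugalOn G β k S | ∀ u ∈ T, c u = c v}) ≤
      #(frugalOn G β k S) := by
  obtain ⟨t, ht⟩ : T.Nonempty := card_pos.1 (by omega)
  have hvT : v ∉ T.erase t := fun h => hv (hT (mem_of_mem_erase h))
  have hcard : #(T.erase t) = β - 1 := by rw [card_erase_of_mem ht, hTcard]
  have hFcard : #(insert v (T.erase t)) = β - 1 + 1 := by rw [card_insert_of_notMem hvT, hcard]
  have hchain := pow_mul_card_frugalOn_sdiff_le G β k hm ih ((erase_subset t T).trans hT)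
  rw [hcard] at hchain
  have hmono := card_frugalOn_monochromatic_mul_le G β k
    (S := S \ T.erase t) (F := insert v (T.erase t)) (t := t)
    (by
      rw [disjoint_insert_right]
      exact ⟨fun h => hv (mem_sdiff.1 h).1, sdiff_disjoint⟩)
    (by
      rw [mem_insert, not_or]
      exact ⟨fun h => hv (h ▸ hT ht), notMem_erase t T⟩)
  rw [hFcard] at hmono
  have hsub : #{c ∈ frugalOn G β k S | ∀ u ∈ T, c u = c v} ≤
      #{c ∈ frugalOn G β k (S \ T.erase t) | ∀ u ∈ insert v (T.erase t), c u = c t} := by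
    refine card_le_card fun c hc => ?_
    rw [mem_filter] at hc ⊢
    refine ⟨frugalOn_anti G β k sdiff_subset hc.1, fun u hu => ?_⟩
    rcases mem_insert.1 hu with rfl | hu
    · exact (hc.2 t ht).symm
    · exact (hc.2 u (mem_of_mem_erase hu)).trans (hc.2 t ht).symm
  have hX : (#{c ∈ frugalOn G β k S | ∀ u ∈ T, c u = c v} : ℝ) * k ^ (β - 1 + 1) ≤
      #(frugalOn G β k (S \ T.erase t)) := by
    exact_mod_cast (Nat.mul_le_mul_right _ hsub).trans hmono
  have hkpos : (0 : ℝ) < k ^ (β - 1) := by positivity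
  refine le_of_mul_le_mul_left (le_trans ?_ hchain) hkpos
  calc _ = m ^ (β - 1) *
        ((#{c ∈ frugalOn G β k S | ∀ u ∈ T, c u = c v} : ℝ) * k ^ (β - 1 + 1)) := by ring
    _ ≤ _ := by gcongr

theorem mul_card_frugalOn_le (G : SimpleGraph V) [DecidableRel G.Adj] {β k D : ℕ}
    (hβ : 1 ≤ β) (hdeg : ∀ v, G.degree v ≤ D) {m : ℝ} (hm : 0 < m)
    (hmβ : m ^ β = (D : ℝ) ^ (β + 1)) (hDm : D ≤ m) (hmk : 3 * m ≤ k) (S : Finset V) :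
    ∀ v ∉ S, m * #(frugalOn G β k S) ≤ k * #(frugalOn G β k (insert v S)) := by
  induction hn : #S using Nat.strong_induction_on generalizing S with
  | _ n ih =>
  subst hn
  replace ih := fun S' h => ih #S' h S' rfl
  intro v hv
  have hk : (0 : ℝ) < k := by linarith
  set N : ℝ := ((#(frugalOn G β k S) : ℕ) : ℝ)
  have hN0 : 0 ≤ N := Nat.cast_nonneg _
  have hadj : ∀ u ∈ G.neighborFinset v,
      (k * #{c ∈ frugalOn G β k S | c v = c u} : ℝ) ≤ N := by
    intro u hu
    have huv : u ∉ ({v} : Finset V) := by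
      simpa using ((G.mem_neighborFinset v u).1 hu).ne'
    have h := card_frugalOn_monochromatic_mul_le G β k (disjoint_singleton_right.2 hv) huv
    simp only [mem_singleton, forall_eq, card_singleton, pow_one] at h
    rw [mul_comm]
    unfold N
    exact_mod_cast h
  have hset : ∀ w, ∀ T ∈ (G.neighborFinset w ∩ S).powersetCard β,
      (k * #{c ∈ frugalOn G β k S | ∀ u ∈ T, c u = c v} : ℝ) ≤ N / m ^ (β - 1) := by
    intro w T hT
    rw [mem_powersetCard] at hT
    rw [le_div_iff₀' (by positivity)]
    exact pow_mul_card_frugalOn_monochromatic_le G hβ (by exact_mod_cast hk) hm.le ih hv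
      (hT.1.trans inter_subset_right) hT.2
  have hnum : ∀ w, (#((G.neighborFinset w ∩ S).powersetCard β) : ℝ) ≤ (D : ℝ) ^ β := by
    intro w
    rw [card_powersetCard]
    have h : #(G.neighborFinset w ∩ S) ≤ D :=
      (card_le_card inter_subset_left).trans ((G.card_neighborFinset_eq_degree w).trans_le (hdeg w))
    exact_mod_cast (Nat.choose_le_pow _ _).trans (Nat.pow_le_pow_left h β)
  have hnbr : (#(G.neighborFinset v) : ℝ) ≤ D := by
    rw [G.card_neighborFinset_eq_degree]
    exact_mod_cast hdeg v
  have hsum₁ : ∑ u ∈ G.neighborFinset v, (k * #{c ∈ frugalOn G β k S | c v = c u} : ℝ) ≤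
      m * N := by
    refine (sum_le_card_nsmul _ _ _ hadj).trans ?_
    rw [nsmul_eq_mul]
    gcongr
    exact hnbr.trans hDm
  have hpow : (D : ℝ) * (D ^ β * (N / m ^ (β - 1))) = m * N := by
    have hmm : m ^ β = m ^ (β - 1) * m := by rw [← pow_succ, Nat.sub_add_cancel hβ]
    have hD : (D : ℝ) * D ^ β = m ^ (β - 1) * m := by rw [← hmm, hmβ, pow_succ, mul_comm]
    rw [← mul_assoc, hD]
    field_simp
  have hsum₂ : ∑ w ∈ G.neighborFinset v, ∑ T ∈ (G.neighborFinset w ∩ S).powersetCard β,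
      (k * #{c ∈ frugalOn G β k S | ∀ u ∈ T, c u = c v} : ℝ) ≤ m * N := by
    rw [← hpow]
    refine (sum_le_card_nsmul _ _ (D ^ β * (N / m ^ (β - 1))) fun w _ => ?_).trans ?_
    · refine (sum_le_card_nsmul _ _ _ (hset w)).trans ?_
      rw [nsmul_eq_mul]
      gcongr
      exact hnum w
    · rw [nsmul_eq_mul]
      gcongr
  have htotal : (k : ℝ) * N ≤ k * (#(frugalOn G β k (insert v S)) +
      (∑ u ∈ G.neighborFinset v, (#{c ∈ frugalOn G β k S | c v = c u} : ℝ) +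
        ∑ w ∈ G.neighborFinset v, ∑ T ∈ (G.neighborFinset w ∩ S).powersetCard β,
          (#{c ∈ frugalOn G β k S | ∀ u ∈ T, c u = c v} : ℝ))) := by
    gcongr
    unfold N
    exact_mod_cast card_frugalOn_le_add G β k S v
  simp only [mul_add, mul_sum] at htotal
  nlinarith [mul_le_mul_of_nonneg_right hmk hN0]

/-- The number of frugal colorings grows by a positive factor with each vertex, hence frugal
colorings exist. -/
theorem frugalOn_nonempty (G : SimpleGraph V) [DecidableRel G.Adj] {β k D : ℕ}
    (hβ : 1 ≤ β) (hdeg : ∀ v, G.degree v ≤ D) {m : ℝ} (hm : 0 < m)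
    (hmβ : m ^ β = (D : ℝ) ^ (β + 1)) (hDm : D ≤ m) (hmk : 3 * m ≤ k) (S : Finset V) :
    (frugalOn G β k S).Nonempty := by
  have hk : (0 : ℝ) < k := by linarith
  induction S using Finset.induction_on with
  | empty => exact ⟨fun _ => ⟨0, by exact_mod_cast hk⟩, by simp [mem_frugalOn]⟩
  | insert v S hv hS =>
    have h := mul_card_frugalOn_le G hβ hdeg hm hmβ hDm hmk S v hv
    have hpos : (0 : ℝ) < #(frugalOn G β k S) := by exact_mod_cast hS.card_pos
    have : (0 : ℝ) < #(frugalOn G β k (insert v S)) :=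
      pos_of_mul_pos_right ((mul_pos hm hpos).trans_le h) hk.le
    exact card_pos.1 (by exact_mod_cast this)

end FrugalCounting

/-- Every graph `G` of maximum degree at most `Δ ≥ 1` admits, for every
integer `β ≥ 1`, a proper `β`-frugal coloring with at most `⌈120·Δ^{1+1/β}⌉` colors: adjacent
vertices get distinct colors, and no color appears more than `β` times in any vertex's
neighborhood. -/
theorem stmt_10 {V : Type*} [Fintype V] (G : SimpleGraph V) [DecidableRel G.Adj]
    (Δ : ℕ) (hΔ : 1 ≤ Δ) (hdeg : G.maxDegree ≤ Δ) (β : ℕ) (hβ : 1 ≤ β) :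
    ∃ c : V → Fin ⌈120 * (Δ : ℝ) ^ ((1 : ℝ) + 1 / (β : ℝ))⌉₊,
      (∀ u v : V, G.Adj u v → c u ≠ c v) ∧
      ∀ v : V, ∀ q, ((G.neighborFinset v).filter fun u => c u = q).card ≤ β := by
  classical
  have hΔ' : (1 : ℝ) ≤ Δ := by exact_mod_cast hΔ
  have hβ' : (0 : ℝ) < β := by exact_mod_cast hβ
  have hm : (0 : ℝ) < (Δ : ℝ) ^ ((1 : ℝ) + 1 / (β : ℝ)) := by positivity
  have hmβ : ((Δ : ℝ) ^ ((1 : ℝ) + 1 / (β : ℝ))) ^ β = (Δ : ℝ) ^ (β + 1) := by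
    rw [← Real.rpow_mul_natCast (by positivity), ← Real.rpow_natCast]
    congr 1
    push_cast
    field_simp
  have hDm : (Δ : ℝ) ≤ (Δ : ℝ) ^ ((1 : ℝ) + 1 / (β : ℝ)) :=
    Real.self_le_rpow_of_one_le hΔ' (by simp)
  have hmk : 3 * (Δ : ℝ) ^ ((1 : ℝ) + 1 / (β : ℝ)) ≤
      ⌈120 * (Δ : ℝ) ^ ((1 : ℝ) + 1 / (β : ℝ))⌉₊ :=
    le_trans (by linarith) (Nat.le_ceil _)
  obtain ⟨c, hc⟩ := frugalOn_nonempty G hβ (fun v => (G.degree_le_maxDegree v).trans hdeg)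
    hm hmβ hDm hmk Finset.univ
  rw [mem_frugalOn] at hc
  exact ⟨c, by simpa using hc.1, by simpa using hc.2⟩
end

section
/- Let G = (V,E) be a finite simple graph, let L ≥ 3 be an integer, and suppose each vertex v is given a finite color list L_v with |L_v| ≥ L. Suppose that for every vertex v and every color q ∈ L_v, the number of neighbors u of v with q ∈ L_u is at most L/8. Then there exists a proper list coloring of G, i.e., a function c with c(v) ∈ L_v for every vertex v and c(u) ≠ c(v) for every edge {u,v} ∈ E. -/
section ListColoringCount

open Classical in
/-- The proper list colorings of the subgraph induced by `S`, extended by the fixed colors `c₀`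
outside `S`. -/
noncomputable def partialListColorings {V α : Type*} [Fintype V]
    (G : SimpleGraph V) (lists : V → Finset α) (c₀ : V → α) (S : Finset V) : Finset (V → α) :=
  (Fintype.piFinset fun v => if v ∈ S then lists v else {c₀ v}).filter fun c =>
    ∀ u ∈ S, ∀ w ∈ S, G.Adj u w → c u ≠ c w

variable {V α : Type*} [Fintype V] {G : SimpleGraph V} {lists : V → Finset α} {c₀ : V → α}

theorem mem_partialListColorings {S : Finset V} {c : V → α} :
    c ∈ partialListColorings G lists c₀ S ↔
      (∀ v ∈ S, c v ∈ lists v) ∧ (∀ v ∉ S, c v = c₀ v) ∧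
        ∀ u ∈ S, ∀ w ∈ S, G.Adj u w → c u ≠ c w := by
  classical
  simp only [partialListColorings, Finset.mem_filter, Fintype.mem_piFinset, ← and_assoc]
  refine and_congr_left fun _ => ⟨fun h => ⟨fun v hv => ?_, fun v hv => ?_⟩, fun h v => ?_⟩
  · simpa [hv] using h v
  · simpa [hv] using h v
  · by_cases hv : v ∈ S
    · simpa [hv] using h.1 v hv
    · simpa [hv] using h.2 v hv

/-- Erasing the color of `u` is injective on the colorings that give `u` a prescribed color. -/
theorem card_partialListColorings_filter_le [DecidableEq V] [DecidableEq α]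
    {S : Finset V} (u : V) (q : α) :
    ((partialListColorings G lists c₀ S).filter fun c => c u = q).card ≤
      (partialListColorings G lists c₀ (S.erase u)).card := by
  refine Finset.card_le_card_of_injOn (fun c => Function.update c u (c₀ u)) ?_ ?_
  · intro c hc
    simp only [Finset.coe_filter, Set.mem_ofPred_eq, mem_partialListColorings] at hc
    obtain ⟨⟨h₁, h₂, h₃⟩, -⟩ := hc
    simp only [Finset.mem_coe, mem_partialListColorings]
    refine ⟨fun v hv => ?_, fun v hv => ?_, fun v hv w hw h => ?_⟩
    · rw [Finset.mem_erase] at hv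
      simpa [hv.1] using h₁ v hv.2
    · by_cases hvu : v = u
      · subst hvu
        simp
      · simpa [hvu] using h₂ v fun hS => hv (Finset.mem_erase.2 ⟨hvu, hS⟩)
    · rw [Finset.mem_erase] at hv hw
      simpa [hv.1, hw.1] using h₃ v hv.2 w hw.2 h
  · intro c hc c' hc' h
    simp only [Finset.coe_filter, Set.mem_ofPred_eq] at hc hc'
    ext w
    by_cases hw : w = u
    · rw [hw, hc.2, hc'.2]
    · simpa [hw] using congrFun h w

/-- A coloring of `S` with no neighbor of `v` colored `q` extends to one of `insert v S` in which
`v` is colored `q`. -/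
theorem card_extendable_le [DecidableEq V] [DecidableEq α] [DecidableRel G.Adj]
    {S : Finset V} {v : V} (hv : v ∉ S) {q : α} (hq : q ∈ lists v) :
    ((partialListColorings G lists c₀ S).filter fun c => ∀ u ∈ S, G.Adj v u → c u ≠ q).card ≤
      ((partialListColorings G lists c₀ (insert v S)).filter fun c => c v = q).card := by
  refine Finset.card_le_card_of_injOn (fun c => Function.update c v q) ?_ ?_
  · intro c hc
    simp only [Finset.coe_filter, Set.mem_ofPred_eq, mem_partialListColorings] at hc
    obtain ⟨⟨h₁, h₂, h₃⟩, h₄⟩ := hc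
    have hne : ∀ {u}, u ∈ S → u ≠ v := fun hu h => hv (h ▸ hu)
    simp only [Finset.coe_filter, Set.mem_ofPred_eq, mem_partialListColorings,
      Function.update_self, and_true]
    refine ⟨fun u hu => ?_, fun u hu => ?_, fun u hu w hw h => ?_⟩
    · rcases Finset.mem_insert.1 hu with rfl | hu
      · simpa using hq
      · simpa [hne hu] using h₁ u hu
    · rw [Finset.mem_insert, not_or] at hu
      simpa [hu.1] using h₂ u hu.2
    · rcases Finset.mem_insert.1 hu with rfl | huS <;>
        rcases Finset.mem_insert.1 hw with rfl | hwS
      · exact (G.loopless.irrefl _ h).elim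
      · simpa [hne hwS] using (h₄ w hwS h).symm
      · simpa [hne huS] using h₄ u huS h.symm
      · simpa [hne huS, hne hwS] using h₃ u huS w hwS h
  · intro c hc c' hc' h
    simp only [Finset.coe_filter, Set.mem_ofPred_eq, mem_partialListColorings] at hc hc'
    ext w
    by_cases hw : w = v
    · rw [hw, hc.1.2.1 v hv, hc'.1.2.1 v hv]
    · simpa [hw] using congrFun h w

/-- The colorings of `S` either extend to `v` with color `q`, or use `q` at a neighbor of `v`. -/
theorem card_partialListColorings_le [DecidableEq V] [DecidableEq α] [DecidableRel G.Adj]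
    {S : Finset V} {v : V} (hv : v ∉ S) {q : α} (hq : q ∈ lists v) :
    (partialListColorings G lists c₀ S).card ≤
      ((partialListColorings G lists c₀ (insert v S)).filter fun c => c v = q).card +
        ∑ u ∈ S with G.Adj v u ∧ q ∈ lists u,
          (partialListColorings G lists c₀ (S.erase u)).card := by
  rw [← Finset.card_filter_add_card_filter_not (fun c : V → α => ∀ u ∈ S, G.Adj v u → c u ≠ q)]
  refine add_le_add (card_extendable_le hv hq) ?_
  refine (Finset.card_le_card fun c hc => ?_).trans
    (Finset.card_biUnion_le.trans
      (Finset.sum_le_sum fun u _ => card_partialListColorings_filter_le (S := S) u q))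
  simp only [Finset.mem_filter, Finset.mem_biUnion] at hc ⊢
  obtain ⟨hc, h⟩ := hc
  push Not at h
  obtain ⟨u, hu, hadj, rfl⟩ := h
  exact ⟨u, ⟨hu, hadj, (mem_partialListColorings.1 hc).1 u hu⟩, hc, rfl⟩

/-- Coloring one more vertex multiplies the number of partial colorings by at least `L / 2`. -/
theorem mul_card_partialListColorings_le [DecidableEq V] [DecidableEq α] [DecidableRel G.Adj]
    {L : ℕ} (hL : 0 < L) (hsize : ∀ v, L ≤ (lists v).card)
    (hconf : ∀ v, ∀ q ∈ lists v,
      8 * ((G.neighborFinset v).filter fun u => q ∈ lists u).card ≤ L)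
    (S : Finset V) : ∀ v ∉ S,
      L * (partialListColorings G lists c₀ S).card ≤
        2 * (partialListColorings G lists c₀ (insert v S)).card := by
  induction S using Finset.strongInduction with
  | H S ih =>
    intro v hv
    set P := (partialListColorings G lists c₀ S).card
    have hconflict : ∀ q ∈ lists v,
        4 * (∑ u ∈ S with G.Adj v u ∧ q ∈ lists u,
          (partialListColorings G lists c₀ (S.erase u)).card) ≤ P := by
      intro q hq
      refine Nat.le_of_mul_le_mul_left ?_ hL
      have hsum : L * (∑ u ∈ S with G.Adj v u ∧ q ∈ lists u,
          (partialListColorings G lists c₀ (S.erase u)).card) ≤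
          (S.filter fun u => G.Adj v u ∧ q ∈ lists u).card * (2 * P) := by
        rw [Finset.mul_sum, ← smul_eq_mul (Finset.card _)]
        refine Finset.sum_le_card_nsmul _ _ _ fun u hu => ?_
        have huS := (Finset.mem_filter.1 hu).1
        simpa [Finset.insert_erase huS] using
          ih _ (Finset.erase_ssubset huS) u (Finset.notMem_erase u S)
      have hcard : 8 * (S.filter fun u => G.Adj v u ∧ q ∈ lists u).card ≤ L := by
        refine le_trans (Nat.mul_le_mul_left _ (Finset.card_le_card fun u hu => ?_)) (hconf v q hq)
        simp only [Finset.mem_filter, SimpleGraph.mem_neighborFinset] at hu ⊢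
        exact hu.2
      nlinarith [Nat.mul_le_mul_right P hcard]
    have hfiber : (partialListColorings G lists c₀ (insert v S)).card =
        ∑ q ∈ lists v,
          ((partialListColorings G lists c₀ (insert v S)).filter fun c => c v = q).card :=
      Finset.card_eq_sum_card_fiberwise fun c hc =>
        (mem_partialListColorings.1 hc).1 v (Finset.mem_insert_self v S)
    have htotal : (lists v).card * (3 * P) ≤
        4 * (partialListColorings G lists c₀ (insert v S)).card := by
      rw [hfiber, Finset.mul_sum, ← smul_eq_mul]
      refine Finset.card_nsmul_le_sum _ _ _ fun q hq => ?_
      have h₁ := card_partialListColorings_le (G := G) (c₀ := c₀) hv hq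
      have h₂ := hconflict q hq
      omega
    nlinarith [Nat.mul_le_mul_right P (hsize v)]

theorem partialListColorings_nonempty [DecidableEq V] [DecidableEq α] [DecidableRel G.Adj]
    {L : ℕ} (hL : 0 < L) (hsize : ∀ v, L ≤ (lists v).card)
    (hconf : ∀ v, ∀ q ∈ lists v,
      8 * ((G.neighborFinset v).filter fun u => q ∈ lists u).card ≤ L)
    (S : Finset V) : (partialListColorings G lists c₀ S).Nonempty := by
  induction S using Finset.induction_on with
  | empty => exact ⟨c₀, by simp [mem_partialListColorings]⟩
  | insert v S hv ih =>
    have h := mul_card_partialListColorings_le (c₀ := c₀) hL hsize hconf S v hv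
    have hpos := Nat.mul_pos hL ih.card_pos
    exact Finset.card_pos.1 (by omega)

end ListColoringCount

/-- (List vertex-coloring.) Let `G` be a finite graph, `L ≥ 3`, and suppose
every vertex `v` has a color list `lists v` of size at least `L` such that for every
`q ∈ lists v`, at most `L/8` neighbors `u` of `v` have `q ∈ lists u`. Then `G` has a proper
list coloring: each vertex gets a color from its own list and adjacent vertices get distinct
colors. -/
theorem stmt_11 {V α : Type*} [Fintype V] [DecidableEq α]
    (G : SimpleGraph V) [DecidableRel G.Adj]
    (L : ℕ) (hL : 3 ≤ L) (lists : V → Finset α)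
    (hsize : ∀ v, L ≤ (lists v).card)
    (hconf : ∀ v : V, ∀ q ∈ lists v,
      (((G.neighborFinset v).filter fun u => q ∈ lists u).card : ℝ) ≤ (L : ℝ) / 8) :
    ∃ c : V → α, (∀ v, c v ∈ lists v) ∧ ∀ u v, G.Adj u v → c u ≠ c v := by
  classical
  have hpos : 0 < L := by omega
  have hne : ∀ v, (lists v).Nonempty := fun v => Finset.card_pos.1 (hpos.trans_le (hsize v))
  choose c₀ _ using hne
  have hconf_nat : ∀ v, ∀ q ∈ lists v,
      8 * ((G.neighborFinset v).filter fun u => q ∈ lists u).card ≤ L := by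
    intro v q hq
    have h := hconf v q hq
    rw [le_div_iff₀ (by norm_num)] at h
    rw [mul_comm]
    exact_mod_cast h
  obtain ⟨c, hc⟩ :=
    partialListColorings_nonempty (c₀ := c₀) hpos hsize hconf_nat Finset.univ
  rw [mem_partialListColorings] at hc
  exact ⟨c, fun v => hc.1 v (Finset.mem_univ v),
    fun u v => hc.2.2 u (Finset.mem_univ u) v (Finset.mem_univ v)⟩
end

section
/- Let V be a finite index set, let (Ω_w, μ_w)_{w∈V} be a family of probability spaces, and let μ be the product measure on Ω = Π_{w∈V} Ω_w. Let A_1, …, A_n ⊆ Ω be events such that each A_j is measurable with respect to the coordinates in a set vbl(A_j) ⊆ V, each A_j satisfies μ(A_j) ≤ q for a real q ≥ 0, and each A_j shares coordinates with at most d ≥ 1 other events, i.e., |{j' ≠ j : vbl(A_j) ∩ vbl(A_{j'}) ≠ ∅}| ≤ d. Then for every subset S ⊆ V there exists a point σ ∈ Π_{w∈S} Ω_w such that for every j ∈ {1,…,n}, the probability of A_j under the measure on Ω obtained by fixing the coordinates in S to σ and taking the product measure Π_{w∉S} μ_w on the remaining coordinates is at most e·(d+1)·q. -/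
open MeasureTheory

/-- The Lovász local lemma with a common weight `x`. -/
theorem measureReal_iInter_compl_pos {Ω ι : Type*} [MeasurableSpace Ω] [Fintype ι] [DecidableEq ι]
    (P : Measure Ω) [IsProbabilityMeasure P] {B : ι → Set Ω} (hB : ∀ i, MeasurableSet (B i))
    (N : ι → Finset ι) {d : ℕ} (hN : ∀ i, (N i).card ≤ d)
    (hind : ∀ i, ∀ T : Finset ι, i ∉ T → Disjoint T (N i) →
      P.real (B i ∩ ⋂ k ∈ T, (B k)ᶜ) = P.real (B i) * P.real (⋂ k ∈ T, (B k)ᶜ))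
    {x : ℝ} (hx0 : 0 ≤ x) (hx1 : x < 1) (hp : ∀ i, P.real (B i) ≤ x * (1 - x) ^ d) :
    0 < P.real (⋂ k, (B k)ᶜ) := by
  have hsplit (i : ι) (T : Finset ι) : P.real (⋂ k ∈ insert i T, (B k)ᶜ) =
      P.real (⋂ k ∈ T, (B k)ᶜ) - P.real (B i ∩ ⋂ k ∈ T, (B k)ᶜ) := by
    have h := measureReal_inter_add_sdiff (μ := P) (s := ⋂ k ∈ T, (B k)ᶜ) (hB i)
    rw [Finset.set_biInter_insert, Set.inter_comm (B i), ← h, Set.sdiff_eq,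
      Set.inter_comm (B i)ᶜ]
    ring
  have hchain (T : Finset ι) (m : ℕ)
      (H : ∀ T' : Finset ι, T'.card < m → ∀ i, i ∉ T' →
        P.real (B i ∩ ⋂ k ∈ T', (B k)ᶜ) ≤ x * P.real (⋂ k ∈ T', (B k)ᶜ)) :
      ∀ U : Finset ι, Disjoint U T → (U ∪ T).card ≤ m →
        (1 - x) ^ U.card * P.real (⋂ k ∈ T, (B k)ᶜ) ≤ P.real (⋂ k ∈ U ∪ T, (B k)ᶜ) := by
    intro U
    induction U using Finset.induction_on with
    | empty => simp
    | insert a U ha ih =>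
      intro hdisj hcard
      rw [Finset.disjoint_insert_left] at hdisj
      have hmem : a ∉ U ∪ T := by simp [ha, hdisj.1]
      rw [Finset.insert_union, Finset.card_insert_of_notMem hmem] at hcard
      rw [Finset.insert_union, hsplit, Finset.card_insert_of_notMem ha, pow_succ]
      have h1 := ih hdisj.2 (by omega)
      have h2 := H (U ∪ T) (by omega) a hmem
      have h3 := mul_le_mul_of_nonneg_left h1 (sub_nonneg.2 hx1.le)
      linarith
  have main : ∀ m : ℕ, ∀ T : Finset ι, T.card < m → ∀ i, i ∉ T →
      P.real (B i ∩ ⋂ k ∈ T, (B k)ᶜ) ≤ x * P.real (⋂ k ∈ T, (B k)ᶜ) := by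
    intro m
    induction m with
    | zero => intro T hT; omega
    | succ m ih =>
      intro T hT i hi
      have hun : (T ∩ N i) ∪ (T \ N i) = T := by
        rw [Finset.union_comm]; exact Finset.sdiff_union_inter T (N i)
      have h1 := hchain (T \ N i) m ih (T ∩ N i)
        (Finset.disjoint_sdiff_inter T (N i)).symm (by rw [hun]; omega)
      rw [hun] at h1
      have hc : (T ∩ N i).card ≤ d := (Finset.card_le_card Finset.inter_subset_right).trans (hN i)
      calc P.real (B i ∩ ⋂ k ∈ T, (B k)ᶜ)
          ≤ P.real (B i ∩ ⋂ k ∈ T \ N i, (B k)ᶜ) :=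
            measureReal_mono (Set.inter_subset_inter_right _
              (Set.biInter_subset_biInter_left fun k hk => (Finset.mem_sdiff.1 hk).1))
        _ = P.real (B i) * P.real (⋂ k ∈ T \ N i, (B k)ᶜ) :=
            hind i _ (fun h => hi (Finset.mem_sdiff.1 h).1) Finset.sdiff_disjoint
        _ ≤ x * (1 - x) ^ d * P.real (⋂ k ∈ T \ N i, (B k)ᶜ) := by
            gcongr; exact hp i
        _ ≤ x * (1 - x) ^ (T ∩ N i).card * P.real (⋂ k ∈ T \ N i, (B k)ᶜ) := by
            have := pow_le_pow_of_le_one (sub_nonneg.2 hx1.le) (by linarith) hc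
            gcongr
        _ ≤ x * P.real (⋂ k ∈ T, (B k)ᶜ) := by
            rw [mul_assoc]; gcongr
  have h := hchain ∅ _ (main _) Finset.univ (by simp) le_rfl
  simp only [Finset.notMem_empty, Set.iInter_of_empty, Set.iInter_univ, probReal_univ, mul_one,
    Finset.union_empty, Finset.mem_univ, Set.iInter_true] at h
  exact (pow_pos (sub_pos.2 hx1) _).trans_le h

theorem inv_exp_mul_le_inv_mul_one_sub_inv_pow {d : ℕ} (hd : 1 ≤ d) :
    (Real.exp 1 * ((d : ℝ) + 1))⁻¹ ≤ ((d : ℝ) + 1)⁻¹ * (1 - ((d : ℝ) + 1)⁻¹) ^ d := by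
  have hd0 : (0 : ℝ) < d := by exact_mod_cast hd
  have h1 : (1 - ((d : ℝ) + 1)⁻¹) = ((d : ℝ)⁻¹ + 1)⁻¹ := by field_simp; ring
  have h2 : ((d : ℝ)⁻¹ + 1) ^ d ≤ Real.exp 1 := by
    calc ((d : ℝ)⁻¹ + 1) ^ d ≤ Real.exp ((d : ℝ)⁻¹) ^ d := by
          gcongr; exact Real.add_one_le_exp _
      _ = Real.exp 1 := by rw [← Real.exp_nat_mul, mul_inv_cancel₀ hd0.ne']
  rw [h1, mul_inv, mul_comm, inv_pow]
  gcongr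

/-- Sectioning an event measurable in the coordinates in `W` along the coordinates satisfying `p`
gives a function measurable in the coordinates in `W` satisfying `p`. -/
theorem measurable_measure_section {V : Type*} {X : V → Type*} [∀ w, MeasurableSpace (X w)]
    (p : V → Prop) [DecidablePred p] (ν : Measure (∀ w : {w // ¬ p w}, X w)) [SFinite ν]
    {W : Set V} {A : Set (∀ w, X w)}
    (hA : MeasurableSet[⨆ w ∈ W,
      MeasurableSpace.comap (fun x : ∀ w, X w => x w) inferInstance] A) :
    Measurable[⨆ w ∈ {w : {w // p w} | (w : V) ∈ W},
        MeasurableSpace.comap (fun x : ∀ w : {w // p w}, X w => x w) inferInstance]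
      fun σ : ∀ w : {w // p w}, X w =>
        ν (Prod.mk σ ⁻¹' ((Equiv.piEquivPiSubtypeProd p X).symm ⁻¹' A)) := by
  set m : MeasurableSpace (∀ w : {w // p w}, X w) :=
    ⨆ w ∈ {w : {w // p w} | (w : V) ∈ W},
      MeasurableSpace.comap (fun x : ∀ w : {w // p w}, X w => x w) inferInstance
  have hglue : @Measurable _ _ (@Prod.instMeasurableSpace _ _ m MeasurableSpace.pi)
      (⨆ w ∈ W, MeasurableSpace.comap (fun x : ∀ w, X w => x w) inferInstance)
      (Equiv.piEquivPiSubtypeProd p X).symm := by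
    rw [measurable_iff_comap_le]
    simp only [MeasurableSpace.comap_iSup, MeasurableSpace.comap_comp]
    refine iSup₂_le fun w hw => ?_
    rw [← measurable_iff_comap_le]
    by_cases h : p w
    · have he : ((fun x : ∀ w, X w => x w) ∘ (Equiv.piEquivPiSubtypeProd p X).symm) =
          fun z => z.1 ⟨w, h⟩ := by
        ext z; simp [Equiv.piEquivPiSubtypeProd, h]
      rw [he]
      have h1 : @Measurable _ _ m _ (fun x : ∀ w : {w // p w}, X w => x ⟨w, h⟩) := by
        rw [measurable_iff_comap_le]
        exact le_iSup₂_of_le (f := fun (w : {w // p w}) (_ : w ∈ {w : {w // p w} | (w : V) ∈ W}) =>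
          MeasurableSpace.comap (fun x : ∀ w : {w // p w}, X w => x w) inferInstance)
          ⟨w, h⟩ hw le_rfl
      exact h1.comp (@measurable_fst _ _ m _)
    · have he : ((fun x : ∀ w, X w => x w) ∘ (Equiv.piEquivPiSubtypeProd p X).symm) =
          fun z => z.2 ⟨w, h⟩ := by
        ext z; simp [Equiv.piEquivPiSubtypeProd, h]
      rw [he]
      exact (measurable_pi_apply _).comp (@measurable_snd _ _ m _)
  exact @measurable_measure_prodMk_left _ _ m _ ν _ _ (hglue hA)

/-- Under a product measure, an event depending on the coordinates in `C i` is independent of the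
avoidance of events depending on coordinates disjoint from `C i`. -/
theorem measureReal_pi_inter_biInter_compl {V ι : Type*} [Fintype V] {X : V → Type*}
    [∀ w, MeasurableSpace (X w)] (μ : ∀ w, Measure (X w)) [∀ w, IsProbabilityMeasure (μ w)]
    {B : ι → Set (∀ w, X w)} {C : ι → Set V}
    (hB : ∀ j, MeasurableSet[⨆ w ∈ C j,
      MeasurableSpace.comap (fun x : ∀ w, X w => x w) inferInstance] (B j))
    (i : ι) (T : Finset ι) (hT : ∀ k ∈ T, Disjoint (C i) (C k)) :
    (Measure.pi μ).real (B i ∩ ⋂ k ∈ T, (B k)ᶜ) =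
      (Measure.pi μ).real (B i) * (Measure.pi μ).real (⋂ k ∈ T, (B k)ᶜ) := by
  have hindep : ProbabilityTheory.iIndep (fun w : V =>
      MeasurableSpace.comap (fun x : ∀ w, X w => x w) inferInstance) (Measure.pi μ) :=
    ProbabilityTheory.iIndepFun_pi (μ := μ) (X := fun w (x : X w) => x) fun w => aemeasurable_id
  have h := ProbabilityTheory.indep_iSup_of_disjoint
    (fun w => (measurable_pi_apply w).comap_le) hindep (S := C i) (T := ⋃ k ∈ T, C k)
    (Set.disjoint_iUnion₂_right.2 hT)
  have hmeas : MeasurableSet[⨆ w ∈ ⋃ k ∈ T, C k,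
      MeasurableSpace.comap (fun x : ∀ w, X w => x w) inferInstance] (⋂ k ∈ T, (B k)ᶜ) := by
    refine Finset.measurableSet_biInter T fun k hk => MeasurableSet.compl ?_
    have hle : (⨆ w ∈ C k, MeasurableSpace.comap (fun x : ∀ w, X w => x w) inferInstance) ≤
        ⨆ w ∈ ⋃ k ∈ T, C k,
          MeasurableSpace.comap (fun x : ∀ w, X w => x w) inferInstance :=
      biSup_mono fun w hw => Set.mem_biUnion hk hw
    exact hle _ (hB k)
  have := (ProbabilityTheory.Indep_iff _ _ _).1 h _ _ (hB i) hmeas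
  simp only [Measure.real, this, ENNReal.toReal_mul]

/-- (LLL-type sectioning.) Let `μ = ⊗_w μ_w` be a product of probability
measures over a finite index set `V`, and let `A_1, …, A_n` be events, each measurable with
respect to the coordinates in `vbl j`, each of probability at most `q`, and each sharing
coordinates with at most `d ≥ 1` other events. Then for every `S ⊆ V` there is a point
`σ ∈ Π_{w∈S} X_w` such that, under the measure obtained by fixing the `S`-coordinates to `σ`
and taking the product measure on the remaining coordinates, every `A_j` has probability at
most `e·(d+1)·q`. -/
theorem stmt_17 {V : Type*} [Fintype V] [DecidableEq V]
    {X : V → Type*} [∀ w, MeasurableSpace (X w)]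
    (μ : ∀ w, Measure (X w)) [∀ w, IsProbabilityMeasure (μ w)]
    (n d : ℕ) (hd : 1 ≤ d) (q : ℝ) (hq : 0 ≤ q)
    (A : Fin n → Set (∀ w, X w)) (vbl : Fin n → Set V)
    (hmeasA : ∀ j, MeasurableSet[⨆ w ∈ vbl j,
        MeasurableSpace.comap (fun x : ∀ w, X w => x w) inferInstance] (A j))
    (hprob : ∀ j, Measure.pi μ (A j) ≤ ENNReal.ofReal q)
    (hdep : ∀ j, Nat.card {j' : Fin n // j' ≠ j ∧ (vbl j ∩ vbl j').Nonempty} ≤ d) :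
    ∀ S : Finset V, ∃ σ : ∀ w : {w : V // w ∈ S}, X w,
      ∀ j, Measure.map
          (fun (y : ∀ w : {w : V // w ∉ S}, X w) (w : V) =>
            if h : w ∈ S then σ ⟨w, h⟩ else y ⟨w, h⟩)
          (Measure.pi fun w : {w : V // w ∉ S} => μ w)
        (A j) ≤ ENNReal.ofReal (Real.exp 1 * ((d : ℝ) + 1) * q) := by
  intro S
  classical
  set P := Measure.pi fun w : {w : V // w ∈ S} => μ w
  set ν := Measure.pi fun w : {w : V // w ∉ S} => μ w
  set G := MeasurableEquiv.piEquivPiSubtypeProd X (· ∈ S)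
  set f : Fin n → (∀ w : {w : V // w ∈ S}, X w) → ENNReal :=
    fun j σ => ν (Prod.mk σ ⁻¹' (G.symm ⁻¹' A j))
  set c := Real.exp 1 * ((d : ℝ) + 1) * q
  set B : Fin n → Set (∀ w : {w : V // w ∈ S}, X w) :=
    fun j => {σ | ENNReal.ofReal c < f j σ}
  have hle {V' : Type _} {Y : V' → Type _} [∀ w, MeasurableSpace (Y w)] (W : Set V') :
      (⨆ w ∈ W, MeasurableSpace.comap (fun x : ∀ w, Y w => x w) inferInstance) ≤
        MeasurableSpace.pi :=
    iSup₂_le fun w _ => (measurable_pi_apply w).comap_le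
  have hA (j) : MeasurableSet (A j) := hle _ _ (hmeasA j)
  have hfm (j) := measurable_measure_section (· ∈ S) ν (hmeasA j)
  have hfm' (j) : Measurable (f j) := (hfm j).mono (hle _) le_rfl
  have hBm (j) : MeasurableSet[⨆ w ∈ {w : {w // w ∈ S} | (w : V) ∈ vbl j},
      MeasurableSpace.comap (fun x : ∀ w : {w // w ∈ S}, X w => x w) inferInstance] (B j) :=
    hfm j measurableSet_Ioi
  have hint (j) : ∫⁻ σ, f j σ ∂P ≤ ENNReal.ofReal q := by
    have hG := (measurePreserving_piEquivPiSubtypeProd μ (· ∈ S)).symm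
    rw [← Measure.prod_apply (G.symm.measurable (hA j))]
    convert (hG.measure_preimage (hA j).nullMeasurableSet).trans_le (hprob j)
  have hPB (j) : P.real (B j) ≤ (Real.exp 1 * ((d : ℝ) + 1))⁻¹ := by
    have hK : (0 : ℝ) < Real.exp 1 * ((d : ℝ) + 1) := by positivity
    rcases hq.eq_or_lt with h0 | hpos
    · have h1 : ∫⁻ σ, f j σ ∂P = 0 := by simpa [← h0] using hint j
      rw [lintegral_eq_zero_iff (hfm' j)] at h1
      have h2 : P (B j) = 0 := by
        refine measure_mono_null (fun σ hσ => ?_) h1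
        exact (bot_le.trans_lt hσ).ne'
      simp only [Measure.real, h2, ENNReal.toReal_zero]
      positivity
    · have h1 : ENNReal.ofReal c * P (B j) ≤ ENNReal.ofReal q :=
        (mul_le_mul' le_rfl (measure_mono fun σ (hσ : _ < f j σ) => hσ.le)).trans
          ((mul_meas_ge_le_lintegral (hfm' j) _).trans (hint j))
      have h2 := ENNReal.toReal_mono ENNReal.ofReal_ne_top h1
      rw [ENNReal.toReal_mul, ENNReal.toReal_ofReal hq,
        ENNReal.toReal_ofReal (by positivity : 0 ≤ c)] at h2
      rw [← one_div, le_div_iff₀ hK]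
      change c * P.real (B j) ≤ q at h2
      refine le_of_mul_le_mul_right ?_ hpos
      calc _ = c * P.real (B j) := by ring
        _ ≤ 1 * q := by linarith
  have hpos : 0 < P.real (⋂ k, (B k)ᶜ) := by
    refine measureReal_iInter_compl_pos P (fun j => hle _ _ (hBm j))
      (fun j => {j' | j' ≠ j ∧ (vbl j ∩ vbl j').Nonempty}) (d := d) (fun j => ?_)
      (fun i T hi hT => ?_) (x := ((d : ℝ) + 1)⁻¹) (by positivity)
      (inv_lt_one_of_one_lt₀ ?_)
      (fun j => (hPB j).trans (inv_exp_mul_le_inv_mul_one_sub_inv_pow hd))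
    · rw [← Fintype.card_subtype, ← Nat.card_eq_fintype_card]
      exact hdep j
    · refine measureReal_pi_inter_biInter_compl _ hBm i T fun k hk => ?_
      have hk' := Finset.disjoint_left.1 hT hk
      rw [Finset.mem_filter_univ] at hk'
      rw [Set.disjoint_left]
      exact fun w hwi hwk => hk' ⟨fun h => hi (h ▸ hk), w, hwi, hwk⟩
    · have : (1 : ℝ) ≤ d := by exact_mod_cast hd
      linarith
  obtain ⟨σ, hσ⟩ : (⋂ k, (B k)ᶜ).Nonempty := by
    rw [Set.nonempty_iff_ne_empty]
    intro h
    simp [h] at hpos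
  refine ⟨σ, fun j => ?_⟩
  have h1 : f j σ ≤ ENNReal.ofReal c := not_lt.1 (Set.mem_iInter.1 hσ j)
  have h2 : Measurable fun y : (∀ w : {w : V // w ∉ S}, X w) => G.symm (σ, y) :=
    G.symm.measurable.comp measurable_prodMk_left
  change Measure.map (fun y => G.symm (σ, y)) ν (A j) ≤ _
  rw [Measure.map_apply h2 (hA j)]
  exact h1
end

section
/- Let G = (V,E) be a finite simple graph, let L ≥ 2 be an integer and C ≥ 1 a real number, and suppose each vertex v is given a color list L_v with |L_v| = L such that for every vertex v and every color q ∈ L_v, the number of neighbors u of v with q ∈ L_u is at most L/C. Assume moreover that 4e·L²·exp(−L/(2C·(log₂ L)⁴)) ≤ 1. Then there exist subsets L'_v ⊆ L_v for all vertices v such that |L'_v| ≥ (L/2)·(1 − 1/(log₂ L)²) for every vertex v, and for every vertex v and every color q ∈ L_v, the number of neighbors u of v with q ∈ L'_u is at most (1 + 1/(log₂ L)²)·L/(2C). -/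
open MeasureTheory ProbabilityTheory Finset

/-- Symmetric **Lovász local lemma**, in conditional form: if each event `A i` has probability at
most `p`, is independent of the avoidance of any family of events not related to it by `r`, and is
related to at most `d` events, where `4 * p * d ≤ 1`, then conditionally on avoiding any subfamily
each event has probability at most `2 * p`. -/
lemma measureReal_inter_iInter_compl_le {Ω ι : Type*} [MeasurableSpace Ω] (μ : Measure Ω)
    [IsProbabilityMeasure μ] (K : Finset ι) (A : ι → Set Ω) (hA : ∀ i ∈ K, MeasurableSet (A i))
    (r : ι → ι → Prop) (p d : ℝ) (hd : 1 ≤ d) (hpd : 4 * p * d ≤ 1)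
    (hp : ∀ i ∈ K, μ.real (A i) ≤ p)
    (hr : ∀ i ∈ K, ∀ S ⊆ K, (∀ j ∈ S, r i j) → (#S : ℝ) ≤ d)
    (hind : ∀ i ∈ K, ∀ S ⊆ K, (∀ j ∈ S, ¬ r i j) →
      μ.real (A i ∩ ⋂ j ∈ S, (A j)ᶜ) = μ.real (A i) * μ.real (⋂ j ∈ S, (A j)ᶜ))
    (S : Finset ι) (hS : S ⊆ K) :
    0 < μ.real (⋂ j ∈ S, (A j)ᶜ) ∧
      ∀ i ∈ K, μ.real (A i ∩ ⋂ j ∈ S, (A j)ᶜ) ≤ 2 * p * μ.real (⋂ j ∈ S, (A j)ᶜ) := by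
  classical
  induction S using Finset.strongInduction with
  | H S ih =>
  have hpos : 0 < μ.real (⋂ j ∈ S, (A j)ᶜ) := by
    rcases S.eq_empty_or_nonempty with rfl | ⟨j, hj⟩
    · simp
    obtain ⟨h0, hle⟩ := ih (S.erase j) (erase_ssubset hj) ((erase_subset _ _).trans hS)
    have hsplit := measureReal_inter_add_sdiff (μ := μ) (s := ⋂ k ∈ S.erase j, (A k)ᶜ) (hA j (hS hj))
    have heq : (⋂ k ∈ S.erase j, (A k)ᶜ) \ A j = ⋂ k ∈ S, (A k)ᶜ := by
      conv_rhs => rw [← insert_erase hj, set_biInter_insert]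
      rw [Set.sdiff_eq, Set.inter_comm]
    rw [heq, Set.inter_comm] at hsplit
    have h := hle j (hS hj)
    have hp0 : 0 ≤ p := measureReal_nonneg.trans (hp j (hS hj))
    nlinarith
  refine ⟨hpos, fun i hi ↦ ?_⟩
  have hp0 : 0 ≤ p := measureReal_nonneg.trans (hp i hi)
  set S₁ := S.filter (r i)
  set S₂ := S.filter (fun j ↦ ¬ r i j)
  have hS₂K : S₂ ⊆ K := (filter_subset _ _).trans hS
  have hS₁K : S₁ ⊆ K := (filter_subset _ _).trans hS
  have hle : μ.real (A i ∩ ⋂ j ∈ S, (A j)ᶜ) ≤ p * μ.real (⋂ j ∈ S₂, (A j)ᶜ) := by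
    have hsub : ⋂ j ∈ S, (A j)ᶜ ⊆ ⋂ j ∈ S₂, (A j)ᶜ :=
      Set.biInter_subset_biInter_left fun j hj ↦ filter_subset _ S hj
    refine (measureReal_mono (Set.inter_subset_inter_right _ hsub)).trans ?_
    rw [hind i hi S₂ hS₂K fun j hj ↦ (mem_filter.1 hj).2]
    exact mul_le_mul_of_nonneg_right (hp i hi) measureReal_nonneg
  have hhalf : μ.real (⋂ j ∈ S₂, (A j)ᶜ) ≤ 2 * μ.real (⋂ j ∈ S, (A j)ᶜ) := by
    by_cases hss : S₂ = S
    · rw [hss]; linarith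
    obtain ⟨-, hj⟩ := ih S₂ ((filter_subset _ _).ssubset_of_ne hss) hS₂K
    have hcover : (⋂ j ∈ S₂, (A j)ᶜ) ⊆
        (⋂ j ∈ S, (A j)ᶜ) ∪ ⋃ k ∈ S₁, (A k ∩ ⋂ j ∈ S₂, (A j)ᶜ) := by
      intro ω hω
      by_cases hk : ∃ k ∈ S₁, ω ∈ A k
      · obtain ⟨k, hk, hωk⟩ := hk
        exact Or.inr (Set.mem_biUnion hk ⟨hωk, hω⟩)
      · left
        simp only [Set.mem_iInter] at hω ⊢
        intro j hj
        by_cases hij : r i j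
        · exact fun h ↦ hk ⟨j, mem_filter.2 ⟨hj, hij⟩, h⟩
        · exact hω j (mem_filter.2 ⟨hj, hij⟩)
    have h₁ : μ.real (⋃ k ∈ S₁, (A k ∩ ⋂ j ∈ S₂, (A j)ᶜ)) ≤
        #S₁ * (2 * p * μ.real (⋂ j ∈ S₂, (A j)ᶜ)) := by
      refine (measureReal_biUnion_finset_le _ _).trans ?_
      rw [← nsmul_eq_mul]
      exact sum_le_card_nsmul _ _ _ fun k hk ↦ hj k (hS₁K hk)
    have h₂ := (measureReal_mono (μ := μ) hcover).trans (measureReal_union_le _ _)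
    have h₃ := hr i hi S₁ hS₁K fun j hj ↦ (mem_filter.1 hj).2
    have h₄ : (#S₁ : ℝ) * (2 * p * μ.real (⋂ j ∈ S₂, (A j)ᶜ)) ≤
        d * (2 * p * μ.real (⋂ j ∈ S₂, (A j)ᶜ)) := by gcongr
    nlinarith [measureReal_nonneg (μ := μ) (s := ⋂ j ∈ S₂, (A j)ᶜ)]
  nlinarith

/-- There are independent fair random bits indexed by any type. -/
lemma exists_iIndepFun_fair_bits.{u} (ι : Type u) :
    ∃ (Ω : Type u) (_ : MeasurableSpace Ω) (μ : Measure Ω) (_ : IsProbabilityMeasure μ)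
      (X : ι → Ω → Bool), (∀ i, Measurable (X i)) ∧ iIndepFun X μ ∧
      ∀ i, ∫ ω, (if X i ω then (1 / 2 : ℝ) else -(1 / 2)) ∂μ = 0 := by
  obtain ⟨Ω, _, μ, X, hX, hlaw, hind, hμ⟩ :=
    exists_iid ι (PMF.uniformOfFintype Bool).toMeasure
  refine ⟨Ω, _, μ, hμ, X, hX, hind, fun i ↦ ?_⟩
  rw [← integral_map (φ := X i) (f := fun b ↦ if b then (1 / 2 : ℝ) else -(1 / 2))
    (hX i).aemeasurable (by fun_prop), (hlaw i).map_eq, PMF.integral_eq_sum]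
  simp

/-- Hoeffding's inequality for a signed sum of at most `N` independent centred fair bits. -/
lemma measureReal_le_signed_sum_bits {Ω ι : Type*} [MeasurableSpace Ω] (μ : Measure Ω)
    [IsProbabilityMeasure μ] (X : ι → Ω → Bool) (hX : ∀ i, Measurable (X i)) (hind : iIndepFun X μ)
    (hmean : ∀ i, ∫ ω, (if X i ω then (1 / 2 : ℝ) else -(1 / 2)) ∂μ = 0)
    (T : Finset ι) (s : ℤˣ) (N t : ℝ) (hT : (#T : ℝ) ≤ N) (ht : 0 < t) :
    μ.real {ω | t ≤ ∑ i ∈ T, ((s : ℤ) : ℝ) * (if X i ω then (1 / 2 : ℝ) else -(1 / 2))} ≤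
      Real.exp (-(2 * t ^ 2 / N)) := by
  rcases T.eq_empty_or_nonempty with rfl | hne
  · simp [not_le.2 ht, Real.exp_nonneg]
  have hcard : (0 : ℝ) < #T := by exact_mod_cast hne.card_pos
  have hmeas : Measurable fun b : Bool ↦ ((s : ℤ) : ℝ) * (if b then (1 / 2 : ℝ) else -(1 / 2)) :=
    measurable_of_countable _
  have hsub : ∀ i ∈ T, HasSubgaussianMGF
      (fun ω ↦ ((s : ℤ) : ℝ) * (if X i ω then (1 / 2 : ℝ) else -(1 / 2)))
      ((‖(1 / 2 : ℝ) - -(1 / 2)‖₊ / 2) ^ 2) μ := by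
    refine fun i _ ↦ hasSubgaussianMGF_of_mem_Icc_of_integral_eq_zero
      (hmeas.comp (hX i)).aemeasurable (.of_forall fun ω ↦ ?_) ?_
    · rcases Int.units_eq_one_or s with rfl | rfl <;> split_ifs <;> norm_num
    · rw [integral_const_mul, hmean, mul_zero]
  refine (HasSubgaussianMGF.measure_sum_ge_le_of_iIndepFun
    (hind.comp (fun _ b ↦ ((s : ℤ) : ℝ) * (if b then (1 / 2 : ℝ) else -(1 / 2))) fun _ ↦ hmeas)
    hsub ht.le).trans (Real.exp_le_exp.2 ?_)
  have hvar : (2 * ((∑ _i ∈ T, (‖(1 / 2 : ℝ) - -(1 / 2)‖₊ / 2) ^ 2 : NNReal) : ℝ)) = #T / 2 := by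
    simp only [sum_const, nsmul_eq_mul]
    push_cast
    norm_num
    ring
  have hN : 2 * t ^ 2 / N ≤ 2 * t ^ 2 / #T := by gcongr
  rw [hvar, neg_div, neg_le_neg_iff]
  refine hN.trans_eq ?_
  field_simp

/-- One-sided local discrepancy: if each set `T i` meets at most `d` of the others and Hoeffding's
bound for exceeding the deviation `t i` is at most `p`, where `4 * p * d ≤ 1`, then some splitting
of the ground set halves every `T i` up to `t i`, in the direction prescribed by `s i`. -/
lemma exists_bits_signed_discrepancy_lt {ι κ : Type*} (K : Finset κ) (T : κ → Finset ι)
    (s : κ → ℤˣ) (N t : κ → ℝ) (p d : ℝ) (hd : 1 ≤ d) (hpd : 4 * p * d ≤ 1)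
    (hT : ∀ i ∈ K, (#(T i) : ℝ) ≤ N i) (ht : ∀ i ∈ K, 0 < t i)
    (hp : ∀ i ∈ K, Real.exp (-(2 * t i ^ 2 / N i)) ≤ p)
    (hr : ∀ i ∈ K, ∀ S ⊆ K, (∀ j ∈ S, ¬ Disjoint (T i) (T j)) → (#S : ℝ) ≤ d) :
    ∃ b : ι → Bool, ∀ i ∈ K,
      ((s i : ℤ) : ℝ) * ((#((T i).filter fun x ↦ b x = true) : ℝ) - #(T i) / 2) < t i := by
  classical
  obtain ⟨Ω, _, μ, _, X, hX, hind, hmean⟩ := exists_iIndepFun_fair_bits ι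
  let A : κ → Set Ω := fun i ↦
    {ω | t i ≤ ∑ x ∈ T i, ((s i : ℤ) : ℝ) * (if X x ω then (1 / 2 : ℝ) else -(1 / 2))}
  let m : ι → MeasurableSpace Ω := fun x ↦ (inferInstance : MeasurableSpace Bool).comap (X x)
  have hm : ∀ x, m x ≤ ‹MeasurableSpace Ω› := fun x ↦ (hX x).comap_le
  have hAm : ∀ (i : κ) (U : Set ι), ↑(T i) ⊆ U → MeasurableSet[⨆ x ∈ U, m x] (A i) := by
    intro i U hU
    have hsum : @Measurable _ _ (⨆ x ∈ U, m x) _ fun ω ↦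
        ∑ x ∈ T i, ((s i : ℤ) : ℝ) * (if X x ω then (1 / 2 : ℝ) else -(1 / 2)) := ?_
    · exact hsum measurableSet_Ici
    refine Finset.measurable_fun_sum _ fun x hx ↦ ?_
    have hXx : @Measurable _ _ (⨆ x ∈ U, m x) _ (X x) :=
      (comap_measurable (X x)).mono (le_biSup m (hU hx)) le_rfl
    exact (measurable_of_countable fun b : Bool ↦
      ((s i : ℤ) : ℝ) * (if b then (1 / 2 : ℝ) else -(1 / 2))).comp hXx
  have hAmeas : ∀ i ∈ K, MeasurableSet (A i) := fun i _ ↦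
    iSup₂_le (fun x _ ↦ hm x) _ (hAm i (T i) subset_rfl)
  obtain ⟨hpos, -⟩ := measureReal_inter_iInter_compl_le μ K A hAmeas
    (fun i j ↦ ¬ Disjoint (T i) (T j)) p d hd hpd
    (fun i hi ↦ (measureReal_le_signed_sum_bits μ X hX hind hmean (T i) (s i) (N i) (t i)
      (hT i hi) (ht i hi)).trans (hp i hi)) hr
    (fun i hi S hS hdis ↦ by
      have hdisj : Disjoint (T i : Set ι) (S.biUnion T : Finset ι) := by
        rw [Finset.disjoint_coe, disjoint_biUnion_right]
        exact fun j hj ↦ not_not.1 (hdis j hj)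
      have hInd := indep_iSup_of_disjoint hm hind.iIndep hdisj
      have hB : MeasurableSet[⨆ x ∈ ((S.biUnion T : Finset ι) : Set ι), m x]
          (⋂ j ∈ S, (A j)ᶜ) :=
        @Finset.measurableSet_biInter _ _ (⨆ x ∈ ((S.biUnion T : Finset ι) : Set ι), m x) _ S
          fun j hj ↦ (hAm j _ (by exact_mod_cast subset_biUnion_of_mem T hj)).compl
      have h := (Indep_iff _ _ μ).1 hInd _ _ (hAm i (T i) subset_rfl) hB
      rw [measureReal_def, h, ENNReal.toReal_mul]
      rfl)
    K subset_rfl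
  obtain ⟨ω, hω⟩ : (⋂ j ∈ K, (A j)ᶜ).Nonempty := by
    by_contra hempty
    rw [Set.not_nonempty_iff_eq_empty.1 hempty] at hpos
    simp at hpos
  refine ⟨fun x ↦ X x ω, fun i hi ↦ ?_⟩
  have h := Set.mem_iInter₂.1 hω i hi
  simp only [A, Set.mem_compl_iff, Set.mem_ofPred_eq, not_le, ← mul_sum] at h
  have hbit : ∀ x, (if X x ω then (1 / 2 : ℝ) else -(1 / 2)) =
      (if X x ω then (1 : ℝ) else 0) - 1 / 2 := fun x ↦ by split_ifs <;> norm_num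
  simp only [hbit, sum_sub_distrib, sum_boole, sum_const, nsmul_eq_mul] at h
  rwa [div_eq_mul_one_div (#(T i) : ℝ)]

/-- (2-factor pruning of color lists.) Let `G` be a finite graph, `L ≥ 2`,
`C ≥ 1`, and suppose each vertex `v` has a color list of size exactly `L` such that for each
color `q` in its list at most `L/C` neighbors `u` of `v` carry `q` in their lists. If
`4e·L²·exp(−L/(2C·(log₂ L)⁴)) ≤ 1`, then there exist sublists `L'_v ⊆ L_v` with
`|L'_v| ≥ (L/2)·(1 − 1/(log₂ L)²)` for every `v`, and for every `v` and `q ∈ L_v` at most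
`(1 + 1/(log₂ L)²)·L/(2C)` neighbors `u` of `v` have `q ∈ L'_u`. -/
theorem stmt_18 {V α : Type*} [Fintype V] [DecidableEq α]
    (G : SimpleGraph V) [DecidableRel G.Adj]
    (L : ℕ) (hL : 2 ≤ L) (C : ℝ) (hC : 1 ≤ C)
    (lists : V → Finset α) (hsize : ∀ v, (lists v).card = L)
    (hconf : ∀ v : V, ∀ q ∈ lists v,
      (((G.neighborFinset v).filter fun u => q ∈ lists u).card : ℝ) ≤ (L : ℝ) / C)
    (hlll : 4 * Real.exp 1 * (L : ℝ) ^ 2 *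
        Real.exp (-(L : ℝ) / (2 * C * (Real.logb 2 L) ^ 4)) ≤ 1) :
    ∃ lists' : V → Finset α, (∀ v, lists' v ⊆ lists v) ∧
      (∀ v, ((L : ℝ) / 2) * (1 - 1 / (Real.logb 2 L) ^ 2) ≤ ((lists' v).card : ℝ)) ∧
      ∀ v : V, ∀ q ∈ lists v,
        (((G.neighborFinset v).filter fun u => q ∈ lists' u).card : ℝ) ≤
          (1 + 1 / (Real.logb 2 L) ^ 2) * ((L : ℝ) / (2 * C)) := by
  classical
  have hL' : (2 : ℝ) ≤ L := by exact_mod_cast hL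
  have hC0 : 0 < C := by linarith
  have hlog : 0 < Real.logb 2 L := Real.logb_pos (by norm_num) (by linarith)
  set ℓ := Real.logb 2 L
  set p := Real.exp (-(L : ℝ) / (2 * C * ℓ ^ 4))
  have hLC : (L : ℝ) / C ≤ L := div_le_self (by linarith) hC
  let T : V ⊕ V × α → Finset (V × α) := Sum.elim
    (fun v ↦ (lists v).image fun q ↦ (v, q))
    (fun x ↦ ((G.neighborFinset x.1).filter fun u ↦ x.2 ∈ lists u).image fun u ↦ (u, x.2))
  let K : Finset (V ⊕ V × α) := (univ : Finset V).disjSum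
    (univ.biUnion fun v ↦ (lists v).image fun q ↦ (v, q))
  have hK : ∀ v q, Sum.inr (v, q) ∈ K ↔ q ∈ lists v := by simp [K]
  have hTl : ∀ v, #(T (Sum.inl v)) = L := fun v ↦ by
    rw [← hsize v]
    exact card_image_of_injective _ fun a b h ↦ (Prod.mk.inj h).2
  have hTr : ∀ v q, #(T (Sum.inr (v, q))) = #((G.neighborFinset v).filter fun u ↦ q ∈ lists u) :=
    fun v q ↦ card_image_of_injective _ fun a b h ↦ (Prod.mk.inj h).1
  have hTmem : ∀ i u q, (u, q) ∈ T i → q ∈ lists u := by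
    rintro (v | ⟨v, q'⟩) u q h
    · simp only [T, Sum.elim_inl, mem_image, Prod.mk.injEq] at h
      obtain ⟨_, h, rfl, rfl⟩ := h
      exact h
    · simp only [T, Sum.elim_inr, mem_image, Prod.mk.injEq, mem_filter] at h
      obtain ⟨_, h, rfl, rfl⟩ := h
      exact h.2
  let N : V ⊕ V × α → ℝ := Sum.elim (fun _ ↦ L) (fun _ ↦ L / C)
  have hTN : ∀ i ∈ K, (#(T i) : ℝ) ≤ N i := by
    rintro (v | ⟨v, q⟩) hi
    · rw [hTl]; rfl
    · rw [hTr]; exact hconf v q ((hK v q).1 hi)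
  have hNL : ∀ i, N i ≤ L := by
    rintro (v | v)
    · exact le_rfl
    · exact hLC
  have hNC : ∀ i, L / C ≤ N i := by
    rintro (v | v)
    · exact hLC
    · exact le_rfl
  have hNpos : ∀ i, 0 < N i := fun i ↦ lt_of_lt_of_le (by positivity) (hNC i)
  have hdeg : ∀ u q, q ∈ lists u → #(K.filter fun j ↦ (u, q) ∈ T j) ≤ L + 1 := by
    intro u q hq
    have hsub : (K.filter fun j ↦ (u, q) ∈ T j) ⊆ insert (Sum.inl u)
        (((G.neighborFinset u).filter fun w ↦ q ∈ lists w).image fun w ↦ Sum.inr (w, q)) := by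
      rintro (v | ⟨v, q'⟩) h
      · simp only [T, mem_filter, Sum.elim_inl, mem_image, Prod.mk.injEq] at h
        obtain ⟨-, _, -, rfl, -⟩ := h
        exact mem_insert_self _ _
      · rw [mem_filter, hK] at h
        simp only [T, Sum.elim_inr, mem_image, Prod.mk.injEq, mem_filter,
          SimpleGraph.mem_neighborFinset] at h
        obtain ⟨hv, _, ⟨hadj, -⟩, rfl, rfl⟩ := h
        exact mem_insert_of_mem (mem_image.2 ⟨v, by simp [hadj.symm, hv], rfl⟩)
    refine (card_le_card hsub).trans ((card_insert_le _ _).trans ?_)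
    have h := (hconf u q hq).trans hLC
    exact Nat.succ_le_succ (card_image_le.trans (by exact_mod_cast h))
  obtain ⟨b, hb⟩ := exists_bits_signed_discrepancy_lt K T
    (Sum.elim (fun _ ↦ -1) (fun _ ↦ 1)) N (fun i ↦ N i / (2 * ℓ ^ 2)) p (2 * (L : ℝ) ^ 2)
    (by nlinarith)
    (by
      have he : (2 : ℝ) ≤ Real.exp 1 := by linarith [Real.add_one_le_exp (1 : ℝ)]
      have hnn : 0 ≤ 4 * (L : ℝ) ^ 2 * p := by positivity
      nlinarith)
    hTN (fun i _ ↦ by have := hNpos i; positivity)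
    (fun i _ ↦ by
      have hi := hNpos i
      refine Real.exp_le_exp.2 ?_
      have h₁ : 2 * (N i / (2 * ℓ ^ 2)) ^ 2 / N i = N i / (2 * ℓ ^ 4) := by
        field_simp
      have h₂ : (L : ℝ) / (2 * C * ℓ ^ 4) = L / C / (2 * ℓ ^ 4) := by
        field_simp
      rw [h₁, neg_div, neg_le_neg_iff, h₂]
      gcongr
      exact hNC i)
    (fun i hi S hS hdis ↦ by
      have hsub : S ⊆ (T i).biUnion fun x ↦ K.filter fun j ↦ x ∈ T j := by
        intro j hj
        obtain ⟨x, hxi, hxj⟩ := Finset.not_disjoint_iff.1 (hdis j hj)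
        exact mem_biUnion.2 ⟨x, hxi, mem_filter.2 ⟨hS hj, hxj⟩⟩
      have hcard := (card_le_card hsub).trans
        (card_biUnion_le_card_mul _ _ (L + 1) fun x hx ↦ hdeg x.1 x.2 (hTmem i x.1 x.2 hx))
      have hcard' : (#S : ℝ) ≤ #(T i) * (L + 1) := by exact_mod_cast hcard
      have hTi := (hTN i hi).trans (hNL i)
      nlinarith)
  refine ⟨fun v ↦ (lists v).filter fun q ↦ b (v, q) = true, fun v ↦ filter_subset _ _,
    fun v ↦ ?_, fun v q hq ↦ ?_⟩
  · have h := hb (Sum.inl v) (by simp [K])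
    have hf : #((T (Sum.inl v)).filter fun x ↦ b x = true) =
        #((lists v).filter fun q ↦ b (v, q) = true) := by
      simp only [T, Sum.elim_inl, filter_image]
      exact card_image_of_injective _ fun a b h ↦ (Prod.mk.inj h).2
    rw [hf, hTl] at h
    simp only [N, Sum.elim_inl, Units.val_neg, Units.val_one, Int.cast_neg, Int.cast_one] at h
    have he : (L : ℝ) / 2 * (1 - 1 / ℓ ^ 2) = L / 2 - L / (2 * ℓ ^ 2) := by
      field_simp
    rw [he]
    linarith
  · have h := hb (Sum.inr (v, q)) ((hK v q).2 hq)
    have hf : #((T (Sum.inr (v, q))).filter fun x ↦ b x = true) =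
        #((G.neighborFinset v).filter fun u ↦ q ∈ (lists u).filter fun q ↦ b (u, q) = true) := by
      simp only [T, Sum.elim_inr, filter_image, filter_filter, mem_filter]
      exact card_image_of_injective _ fun a b h ↦ (Prod.mk.inj h).1
    rw [hf, hTr] at h
    simp only [N, Sum.elim_inr, Units.val_one, Int.cast_one, one_mul] at h
    have he : (1 + 1 / ℓ ^ 2) * ((L : ℝ) / (2 * C)) = L / C / 2 + L / C / (2 * ℓ ^ 2) := by
      field_simp
    rw [he]
    linarith [hconf v q hq]
end
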